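/- arXiv:1102.0102 — 3 statements merged into one kernel-verified Lean document; each statement's English description precedes it below -/
import Mathlib

section
/- Let X be a locally n-connected metric space. Then for every x ∈ X, the topological n-th homotopy group π_n^top(X, x) is discrete; equivalently, the path components of the based n-loop space Ω^n(X, x) (with the compact-open, equivalently uniform-convergence, topology) are open. -/
open scoped unitInterval Topology
open Set Filter

noncomputable instance homotopyGroupTopologicalSpace (N X : Type*) [TopologicalSpace X]
    (x : X) : TopologicalSpace (HomotopyGroup N X x) :=
  instTopologicalSpaceQuotient

/-- A based k-loop p is nullhomotopic within U if there is a homotopy rel the cube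
boundary from p to the constant loop, taking all its values in U. -/
def GenLoop.NullHomotopicIn {X : Type*} [TopologicalSpace X] {k : ℕ} {y : X}
    (p : GenLoop (Fin k) X y) (U : Set X) : Prop :=
  ∃ H : ContinuousMap.HomotopyRel p.1 (ContinuousMap.const (Fin k → I) y)
      (Cube.boundary (Fin k)),
    ∀ z, H z ∈ U

/-- X is locally n-connected: every point has arbitrarily small neighborhoods V inside
any neighborhood U such that π_k(V) → π_k(U) is trivial for all 0 ≤ k ≤ n and all
basepoints in V. -/
def LocallyNConnected (n : ℕ) (X : Type*) [TopologicalSpace X] : Prop :=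
  ∀ (x : X) (U : Set X), IsOpen U → x ∈ U →
    ∃ V : Set X, IsOpen V ∧ x ∈ V ∧ V ⊆ U ∧
      ∀ k ≤ n, ∀ y ∈ V, ∀ p : GenLoop (Fin k) X y,
        (∀ t, p t ∈ V) → GenLoop.NullHomotopicIn p U

/-- Locally, maps from the boundary of a cube of dimension at most `m + 1` extend over the cube:
the unbased form of local `m`-connectedness. -/
def LocallyFillsCubes (m : ℕ) (X : Type*) [TopologicalSpace X] : Prop :=
  ∀ (x : X), ∀ U ∈ 𝓝 x, ∃ V ∈ 𝓝 x, ∀ k ≤ m, ∀ φ : (Fin (k + 1) → I) → X,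
    ContinuousOn φ (Cube.boundary (Fin (k + 1))) →
    MapsTo φ (Cube.boundary (Fin (k + 1))) V →
    ∃ G : C(Fin (k + 1) → I, X), EqOn G φ (Cube.boundary (Fin (k + 1))) ∧ ∀ u, G u ∈ U

theorem LocallyFillsCubes.of_homeomorph {m : ℕ} {X Y : Type*} [TopologicalSpace X]
    [TopologicalSpace Y] (h : LocallyFillsCubes m X) (e : Y ≃ₜ X) : LocallyFillsCubes m Y := by
  intro y U hU
  obtain ⟨V, hV, hfill⟩ := h (e y) (e.symm ⁻¹' U)
    (e.symm.continuous.continuousAt.preimage_mem_nhds (by simpa using hU))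
  refine ⟨e ⁻¹' V, e.continuous.continuousAt.preimage_mem_nhds hV, fun k hk φ hφ hφV => ?_⟩
  obtain ⟨G, hG, hGU⟩ := hfill k hk (e ∘ φ) (e.continuous.comp_continuousOn hφ)
    (fun u hu => hφV hu)
  refine ⟨⟨e.symm ∘ G, by fun_prop⟩, fun u hu => ?_, hGU⟩
  simp [hG hu]

theorem Cube.eq_zero_or_eq_one_of_mem_boundary {u : Fin 1 → I}
    (hu : u ∈ Cube.boundary (Fin 1)) : u = 0 ∨ u = 1 := by
  obtain ⟨i, hi⟩ := hu
  exact hi.imp (fun h => funext fun j => Subsingleton.elim i j ▸ h)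
    fun h => funext fun j => Subsingleton.elim i j ▸ h

theorem LocallyFillsCubes.joined_nhds {X : Type*} [TopologicalSpace X]
    (h : LocallyFillsCubes 0 X) (x : X) : ∀ᶠ y in 𝓝 x, Joined x y := by
  obtain ⟨V, hV, hfill⟩ := h x univ univ_mem
  filter_upwards [hV] with y hy
  classical
  have hfin : (Cube.boundary (Fin 1)).Finite := by
    refine (Set.toFinite ({0, 1} : Set (Fin 1 → I))).subset ?_
    exact fun u => Cube.eq_zero_or_eq_one_of_mem_boundary
  obtain ⟨G, hG, -⟩ := hfill 0 le_rfl (fun u => if u 0 = 0 then x else y) (hfin.continuousOn _) (by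
    intro u _
    dsimp only
    split_ifs
    exacts [mem_of_mem_nhds hV, hy])
  refine ⟨⟨⟨fun t => G fun _ => t, by fun_prop⟩, ?_, ?_⟩⟩
  · exact (hG ⟨0, Or.inl rfl⟩).trans (if_pos rfl)
  · exact (hG ⟨0, Or.inr rfl⟩).trans (if_neg one_ne_zero)

theorem isOpen_pathComponent_of_joined_nhds {X : Type*} [TopologicalSpace X]
    (h : ∀ x : X, ∀ᶠ y in 𝓝 x, Joined x y) (x : X) : IsOpen (pathComponent x) := by
  rw [isOpen_iff_mem_nhds]
  intro y hy
  filter_upwards [h y] with z hz using Joined.trans hy hz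

theorem GenLoop.homotopic_of_joined {N X : Type*} [TopologicalSpace X] {x : X}
    {p q : GenLoop N X x} (h : Joined p q) : GenLoop.Homotopic p q := by
  obtain ⟨γ⟩ := h
  refine ⟨⟨⟨⟨fun z => γ z.1 z.2, by fun_prop⟩, fun u => ?_, fun u => ?_⟩, fun t u hu => ?_⟩⟩
  · simp
  · simp
  · exact ((γ t).2 u hu).trans (p.2 u hu).symm

/-- On a compact set, the sizes in `LocallyFillsCubes` can be chosen uniformly. -/
theorem LocallyFillsCubes.exists_uniform {m : ℕ} {X : Type*} [PseudoMetricSpace X]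
    (h : LocallyFillsCubes m X) {K : Set X} (hK : IsCompact K) {ε : ℝ} (hε : 0 < ε) :
    ∃ δ > 0, ∀ z ∈ K, ∀ k ≤ m, ∀ φ : (Fin (k + 1) → I) → X,
      ContinuousOn φ (Cube.boundary (Fin (k + 1))) →
      (∀ u ∈ Cube.boundary (Fin (k + 1)), dist (φ u) z < δ) →
      ∃ G : C(Fin (k + 1) → I, X), EqOn G φ (Cube.boundary (Fin (k + 1))) ∧
        ∀ u, dist (G u) z < ε := by
  choose V hV hfill using fun z : X => h z (Metric.ball z (ε / 2))
    (Metric.ball_mem_nhds z (half_pos hε))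
  obtain ⟨δ, hδ, hcover⟩ := lebesgue_number_lemma_of_metric hK
    (c := fun z => interior (V z ∩ Metric.ball z (ε / 2))) (fun _ => isOpen_interior)
    (fun z _ => mem_iUnion.2 ⟨z, mem_interior_iff_mem_nhds.2
      (inter_mem (hV z) (Metric.ball_mem_nhds z (half_pos hε)))⟩)
  refine ⟨δ, hδ, fun z hz k hk φ hφ hφz => ?_⟩
  obtain ⟨w, hw⟩ := hcover z hz
  have hw' := hw.trans interior_subset
  obtain ⟨G, hG, hGw⟩ := hfill w k hk φ hφ (fun u hu => (hw' (hφz u hu)).1)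
  refine ⟨G, hG, fun u => ?_⟩
  have h1 : dist (G u) w < ε / 2 := hGw u
  have h2 : dist z w < ε / 2 := (hw' (Metric.mem_ball_self hδ)).2
  linarith [dist_triangle_right (G u) z w]

theorem Cube.isClosed_boundary (N : Type*) [Finite N] : IsClosed (Cube.boundary N) := by
  have : Cube.boundary N = ⋃ i : N, {u | u i = 0} ∪ {u | u i = 1} := by
    ext u; simp [Cube.boundary]
  rw [this]
  exact isClosed_iUnion_of_finite fun i =>
    (isClosed_eq (continuous_apply i) continuous_const).union
      (isClosed_eq (continuous_apply i) continuous_const)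

theorem Cube.mem_boundary_succ {k : ℕ} {u : Fin (k + 1) → I} :
    u ∈ Cube.boundary (Fin (k + 1)) ↔
      (u 0 = 0 ∨ u 0 = 1) ∨ Fin.tail u ∈ Cube.boundary (Fin k) := by
  simp [Cube.boundary, Fin.exists_fin_succ, Fin.tail]

/-- The boundary of a prism over a cube can be filled as soon as the boundary of the cube of one
dimension more can. -/
theorem exists_prism_filling {X : Type*} [TopologicalSpace X] {k : ℕ} {V U : Set X}
    (hfill : ∀ φ : (Fin (k + 1) → I) → X, ContinuousOn φ (Cube.boundary (Fin (k + 1))) →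
      MapsTo φ (Cube.boundary (Fin (k + 1))) V →
      ∃ G : C(Fin (k + 1) → I, X), EqOn G φ (Cube.boundary (Fin (k + 1))) ∧ ∀ u, G u ∈ U)
    {a b : ℝ} (hab : a < b) (Φ : (Fin k → I) → ℝ → X)
    (hΦ : ContinuousOn (fun z : (Fin k → I) × ℝ => Φ z.1 z.2) (Cube.boundary (Fin k) ×ˢ univ))
    (A B : C(Fin k → I, X)) (hA : ∀ u ∈ Cube.boundary (Fin k), A u = Φ u a)
    (hB : ∀ u ∈ Cube.boundary (Fin k), B u = Φ u b)
    (hAV : ∀ u, A u ∈ V) (hBV : ∀ u, B u ∈ V)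
    (hΦV : ∀ u ∈ Cube.boundary (Fin k), ∀ t ∈ Icc a b, Φ u t ∈ V) :
    ∃ F : C((Fin k → I) × ℝ, X), (∀ u, F (u, a) = A u) ∧ (∀ u, F (u, b) = B u) ∧
      (∀ u ∈ Cube.boundary (Fin k), ∀ t ∈ Icc a b, F (u, t) = Φ u t) ∧ ∀ z, F z ∈ U := by
  classical
  set φ : (Fin (k + 1) → I) → X := fun w =>
    if w 0 = 0 then A (Fin.tail w) else if w 0 = 1 then B (Fin.tail w)
      else Φ (Fin.tail w) (a + (b - a) * w 0) with hφdef
  have hφ0 : ∀ w, w 0 = 0 → φ w = A (Fin.tail w) := fun w hw => by simp [hφdef, hw]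
  have hφ1 : ∀ w, w 0 = 1 → φ w = B (Fin.tail w) := fun w hw => by simp [hφdef, hw]
  have hφb : ∀ w : Fin (k + 1) → I, Fin.tail w ∈ Cube.boundary (Fin k) →
      φ w = Φ (Fin.tail w) (a + (b - a) * w 0) := by
    intro w hw
    by_cases h0 : w 0 = 0
    · rw [hφ0 w h0, hA _ hw, h0]; simp
    by_cases h1 : w 0 = 1
    · rw [hφ1 w h1, hB _ hw, h1]; simp
    simp [hφdef, h0, h1]
  have htail : Continuous (Fin.tail : (Fin (k + 1) → I) → Fin k → I) := by
    unfold Fin.tail; fun_prop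
  have hbd : Cube.boundary (Fin (k + 1)) =
      ({w | w 0 = 0} ∪ {w | w 0 = 1}) ∪ Fin.tail ⁻¹' Cube.boundary (Fin k) := by
    ext w; exact Cube.mem_boundary_succ
  have hc0 : IsClosed {w : Fin (k + 1) → I | w 0 = 0} :=
    isClosed_eq (continuous_apply 0) continuous_const
  have hc1 : IsClosed {w : Fin (k + 1) → I | w 0 = 1} :=
    isClosed_eq (continuous_apply 0) continuous_const
  have hcont : ContinuousOn φ (Cube.boundary (Fin (k + 1))) := by
    rw [hbd]
    refine ContinuousOn.union_of_isClosed (ContinuousOn.union_of_isClosed ?_ ?_ hc0 hc1) ?_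
      (hc0.union hc1) ((Cube.isClosed_boundary _).preimage htail)
    · exact (A.continuous.comp htail).continuousOn.congr hφ0
    · exact (B.continuous.comp htail).continuousOn.congr hφ1
    · refine ContinuousOn.congr (hΦ.comp (f := fun w : Fin (k + 1) → I =>
        (Fin.tail w, a + (b - a) * (w 0 : ℝ))) (by fun_prop) ?_) hφb
      exact fun w hw => ⟨hw, mem_univ _⟩
  have hmaps : MapsTo φ (Cube.boundary (Fin (k + 1))) V := by
    rw [hbd]
    rintro w ((hw | hw) | hw)
    · rw [hφ0 w hw]; exact hAV _
    · rw [hφ1 w hw]; exact hBV _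
    · rw [hφb w hw]
      refine hΦV _ hw _ ⟨?_, ?_⟩
      · nlinarith [(w 0).2.1]
      · nlinarith [(w 0).2.2]
  obtain ⟨G, hG, hGU⟩ := hfill φ hcont hmaps
  have hba : b - a ≠ 0 := (sub_pos.2 hab).ne'
  refine ⟨⟨fun z => G (Fin.cons (projIcc 0 1 zero_le_one ((z.2 - a) / (b - a))) z.1), ?_⟩,
    fun u => ?_, fun u => ?_, fun u hu t ht => ?_, fun z => hGU _⟩
  · refine G.continuous.comp (Continuous.finCons ?_ continuous_fst)
    exact continuous_projIcc.comp (by fun_prop)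
  · have : projIcc (0 : ℝ) 1 zero_le_one ((a - a) / (b - a)) = 0 := by simp
    simp only [ContinuousMap.coe_mk, this]
    rw [hG (Cube.mem_boundary_succ.2 (Or.inl (Or.inl (by simp)))), hφ0 _ (by simp)]
    simp
  · have : projIcc (0 : ℝ) 1 zero_le_one ((b - a) / (b - a)) = 1 := by simp [div_self hba]
    simp only [ContinuousMap.coe_mk, this]
    rw [hG (Cube.mem_boundary_succ.2 (Or.inl (Or.inr (by simp)))), hφ1 _ (by simp)]
    simp
  · have hmem : (t - a) / (b - a) ∈ Icc (0 : ℝ) 1 :=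
      ⟨div_nonneg (sub_nonneg.2 ht.1) (sub_pos.2 hab).le,
        (div_le_one (sub_pos.2 hab)).2 (by linarith [ht.2])⟩
    simp only [ContinuousMap.coe_mk, projIcc_of_mem _ hmem]
    rw [hG (Cube.mem_boundary_succ.2 (Or.inr (by simpa using hu))), hφb _ (by simpa using hu)]
    simp only [Fin.tail_cons, Fin.cons_zero]
    congr 1
    field_simp
    ring

/-- A family of paths parametrized by the boundary of a cube and staying close to `γ` extends over
the cube as soon as fillings `C t` at all times are given and short prisms can be filled. -/
theorem exists_filling_Icc {X : Type*} [PseudoMetricSpace X] {k : ℕ} {γ : ℝ → X} {ε : ℝ}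
    {Φ : (Fin k → I) → ℝ → X} {C : ℝ → C(Fin k → I, X)} {η : ℝ}
    (hC : ∀ t, ∀ u ∈ Cube.boundary (Fin k), C t u = Φ u t)
    (hCγ : ∀ u, dist (C 0 u) (γ 0) < ε)
    (hprism : ∀ a b : ℝ, a < b → b = a + η → ∃ F : C((Fin k → I) × ℝ, X),
      (∀ u, F (u, a) = C a u) ∧ (∀ u, F (u, b) = C b u) ∧
      (∀ u ∈ Cube.boundary (Fin k), ∀ t ∈ Icc a b, F (u, t) = Φ u t) ∧
      ∀ u, ∀ t ∈ Icc a b, dist (F (u, t)) (γ t) < ε)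
    (hη : 0 < η) (i : ℕ) :
    ∃ F : (Fin k → I) × ℝ → X, ContinuousOn F (univ ×ˢ Icc 0 (i * η)) ∧
      (∀ u, F (u, 0) = C 0 u) ∧ (∀ u, F (u, i * η) = C (i * η) u) ∧
      (∀ u ∈ Cube.boundary (Fin k), ∀ t ∈ Icc 0 (i * η), F (u, t) = Φ u t) ∧
      ∀ u, ∀ t ∈ Icc 0 (i * η), dist (F (u, t)) (γ t) < ε := by
  induction i with
  | zero =>
    refine ⟨fun z => C 0 z.1, by fun_prop, fun u => rfl, fun u => by simp, fun u hu t ht => ?_,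
      fun u t ht => ?_⟩
    all_goals obtain rfl : t = 0 := by simpa using ht
    · exact hC 0 u hu
    · exact hCγ u
  | succ i ih =>
    obtain ⟨F, hF, hF0, hFi, hFΦ, hFγ⟩ := ih
    set a : ℝ := i * η with ha
    have ha0 : 0 ≤ a := by positivity
    have hb : ((i + 1 : ℕ) : ℝ) * η = a + η := by push_cast; ring
    rw [hb]
    obtain ⟨P, hPa, hPb, hPΦ, hPγ⟩ := hprism a (a + η) (by linarith) rfl
    classical
    set Q : (Fin k → I) × ℝ → X := fun z => if z.2 ≤ a then F z else P z with hQ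
    have hQ1 : ∀ z : (Fin k → I) × ℝ, z.2 ≤ a → Q z = F z := fun z hz => if_pos hz
    have hQ2 : ∀ z : (Fin k → I) × ℝ, a ≤ z.2 → Q z = P z := by
      rintro ⟨u, t⟩ hz
      rcases eq_or_lt_of_le hz with h | h
      · dsimp only at h
        subst t
        rw [hQ1 _ le_rfl, hPa, hFi]
      · exact if_neg (not_le.2 h)
    refine ⟨Q, ?_, fun u => ?_, fun u => ?_, fun u hu t ht => ?_, fun u t ht => ?_⟩
    · rw [← Icc_union_Icc_eq_Icc ha0 (by linarith : a ≤ a + η), prod_union]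
      refine ContinuousOn.union_of_isClosed (hF.congr fun z hz => hQ1 z hz.2.2)
        (P.continuous.continuousOn.congr fun z hz => hQ2 z hz.2.1)
        (isClosed_univ.prod isClosed_Icc) (isClosed_univ.prod isClosed_Icc)
    · rw [hQ1 _ ha0, hF0]
    · rw [hQ2 _ (by simpa using hη.le), hPb]
    · rcases le_total t a with h | h
      · rw [hQ1 _ h, hFΦ u hu t ⟨ht.1, h⟩]
      · rw [hQ2 _ h, hPΦ u hu t ⟨h, ht.2⟩]
    · rcases le_total t a with h | h
      · rw [hQ1 _ h]; exact hFγ u t ⟨ht.1, h⟩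
      · rw [hQ2 _ h]; exact hPγ u t ⟨h, ht.2⟩

theorem Path.hasBasis_nhds_dist {X : Type*} [PseudoMetricSpace X] {x y : X} (γ : Path x y) :
    (𝓝 γ).HasBasis (fun ε : ℝ => 0 < ε) fun ε => {γ' | ∀ t, dist (γ' t) (γ t) < ε} := by
  have h : (𝓝 γ) = comap (fun γ' : Path x y => (γ' : C(I, X))) (𝓝 (γ : C(I, X))) :=
    nhds_induced _ _
  rw [h]
  refine (Metric.nhds_basis_ball.comap _).congr (fun _ => Iff.rfl) fun ε hε => ?_
  ext γ'
  simp [ContinuousMap.dist_lt_iff hε]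

theorem LocallyFillsCubes.path {m : ℕ} {X : Type*} [PseudoMetricSpace X]
    (h : LocallyFillsCubes (m + 1) X) (x y : X) : LocallyFillsCubes m (Path x y) := by
  intro γ U hU
  obtain ⟨ε, hε, hεU⟩ := γ.hasBasis_nhds_dist.mem_iff.1 hU
  have hK : IsCompact (range γ) := isCompact_range γ.continuous
  obtain ⟨δ₂, hδ₂, hfill₂⟩ := h.exists_uniform hK (half_pos hε)
  obtain ⟨δ₁, hδ₁, hfill₁⟩ := h.exists_uniform hK (lt_min (half_pos hδ₂) hε)
  refine ⟨_, γ.hasBasis_nhds_dist.mem_of_mem (lt_min hδ₁ (half_pos hδ₂)), fun k hk φ hφ hφγ => ?_⟩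
  have hγK : ∀ t : ℝ, γ.extend t ∈ range γ := fun t => ⟨_, rfl⟩
  have hφγ' : ∀ u ∈ Cube.boundary (Fin (k + 1)), ∀ t : ℝ,
      dist ((φ u).extend t) (γ.extend t) < min δ₁ (δ₂ / 2) := fun u hu t => hφγ hu _
  have hΦ : ContinuousOn (fun z : (Fin (k + 1) → I) × ℝ => (φ z.1).extend z.2)
      (Cube.boundary (Fin (k + 1)) ×ˢ univ) := by
    have : ContinuousOn (fun z : (Fin (k + 1) → I) × ℝ => φ z.1)
        (Cube.boundary (Fin (k + 1)) ×ˢ univ) :=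
      hφ.comp continuousOn_fst fun z hz => hz.1
    exact this.eval (continuous_projIcc.comp continuous_snd).continuousOn
  have hslice : ∀ t : ℝ, ∃ G : C(Fin (k + 1) → I, X),
      EqOn G (fun u => (φ u).extend t) (Cube.boundary (Fin (k + 1))) ∧
      (∀ u, dist (G u) (γ.extend t) < min (δ₂ / 2) ε) ∧
      (t = 0 → ∀ u, G u = x) ∧ (t = 1 → ∀ u, G u = y) := by
    intro t
    have hpos := lt_min (half_pos hδ₂) hε
    rcases eq_or_ne t 0 with rfl | h0
    · exact ⟨.const _ x, fun u _ => by simp, fun u => by simpa using hpos,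
        fun _ _ => rfl, fun h => absurd h (by norm_num)⟩
    rcases eq_or_ne t 1 with rfl | h1
    · exact ⟨.const _ y, fun u _ => by simp, fun u => by simpa using hpos,
        fun h => absurd h (by norm_num), fun _ _ => rfl⟩
    obtain ⟨G, hG, hGγ⟩ := hfill₁ (γ.extend t) (hγK t) k (by lia) (fun u => (φ u).extend t)
      (hΦ.comp (f := fun u => (u, t)) (by fun_prop) fun u hu => ⟨hu, mem_univ _⟩)
      (fun u hu => (hφγ' u hu t).trans_le (min_le_left _ _))
    exact ⟨G, hG, hGγ, fun h => absurd h h0, fun h => absurd h h1⟩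
  choose C hC hCγ hC0 hC1 using hslice
  have huc : UniformContinuous γ.extend :=
    (CompactSpace.uniformContinuous_of_continuous γ.continuous).comp
      (LipschitzWith.projIcc zero_le_one).uniformContinuous
  obtain ⟨η, hη, hηγ⟩ := Metric.uniformContinuous_iff.1 huc _
    (lt_min (half_pos hδ₂) (half_pos hε))
  obtain ⟨N, hN⟩ := exists_nat_one_div_lt hη
  have hN0 : (0 : ℝ) < 1 / ((N : ℝ) + 1) := by positivity
  obtain ⟨F, hF, hF0, hF1, hFΦ, hFγ⟩ := exists_filling_Icc (γ := γ.extend) (ε := ε)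
    (Φ := fun u => (φ u).extend) (C := C) (η := 1 / ((N : ℝ) + 1)) (fun t u hu => hC t hu)
    (fun u => (hCγ 0 u).trans_le (min_le_right _ _)) (by
      intro a b hab hb
      have hclose : ∀ t ∈ Icc a b, dist (γ.extend t) (γ.extend a) < min (δ₂ / 2) (ε / 2) := by
        intro t ht
        apply hηγ
        rw [Real.dist_eq, abs_of_nonneg (by linarith [ht.1])]
        linarith [ht.2]
      have hnear : ∀ (p : X), ∀ t ∈ Icc a b, dist p (γ.extend t) < δ₂ / 2 →
          p ∈ Metric.ball (γ.extend a) δ₂ := by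
        intro p t ht hp
        have := (hclose t ht).trans_le (min_le_left _ _)
        rw [Metric.mem_ball]
        linarith [dist_triangle p (γ.extend t) (γ.extend a)]
      obtain ⟨P, hPa, hPb, hPΦ, hPγ⟩ := exists_prism_filling
        (U := Metric.ball (γ.extend a) (ε / 2))
        (hfill₂ (γ.extend a) (hγK a) (k + 1) (by lia)) hab (fun u => (φ u).extend) hΦ (C a) (C b) (fun u hu => hC a hu)
          (fun u hu => hC b hu)
        (fun u => hnear _ a (left_mem_Icc.2 hab.le) ((hCγ a u).trans_le (min_le_left _ _)))
        (fun u => hnear _ b (right_mem_Icc.2 hab.le) ((hCγ b u).trans_le (min_le_left _ _)))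
        (fun u hu t ht => hnear _ t ht ((hφγ' u hu t).trans_le (min_le_right _ _)))
      refine ⟨P, hPa, hPb, hPΦ, fun u t ht => ?_⟩
      have h1 : dist (P (u, t)) (γ.extend a) < ε / 2 := hPγ (u, t)
      have h2 := (hclose t ht).trans_le (min_le_right _ _)
      linarith [dist_triangle_right (P (u, t)) (γ.extend t) (γ.extend a)]) hN0 (N + 1)
  have hone : ((N + 1 : ℕ) : ℝ) * (1 / ((N : ℝ) + 1)) = 1 := by
    push_cast; field_simp
  rw [hone] at hF hF1 hFΦ hFγ
  have hFc : Continuous fun z : (Fin (k + 1) → I) × I => F (z.1, (z.2 : ℝ)) :=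
    hF.comp_continuous (by fun_prop) fun z => ⟨mem_univ _, z.2.2⟩
  let G : (Fin (k + 1) → I) → Path x y := fun u =>
    { toFun := fun t => F (u, (t : ℝ))
      continuous_toFun := hFc.comp (by fun_prop : Continuous fun t : I => (u, t))
      source' := by simpa [hF0] using hC0 0 rfl u
      target' := by simpa [hF1] using hC1 1 rfl u }
  refine ⟨⟨G, Path.continuous_uncurry_iff.1 hFc⟩, fun u hu => ?_, fun u => hεU fun t => ?_⟩
  · ext t
    exact (hFΦ u hu t t.2).trans (Path.extend_apply _ t.2)
  · have := hFγ u t t.2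
    rwa [Path.extend_apply _ t.2] at this

theorem LocallyFillsCubes.genLoop {m : ℕ} {N : Type} [Finite N] {X : Type*} [MetricSpace X]
    (h : LocallyFillsCubes (m + Nat.card N) X) (x : X) :
    LocallyFillsCubes m (GenLoop N X x) := by
  classical
  induction hj : Nat.card N generalizing N m with
  | zero =>
    have : IsEmpty N := (Nat.card_eq_zero.1 hj).resolve_right (not_infinite_iff_finite.2 ‹_›)
    rw [hj] at h
    exact h.of_homeomorph (genLoopHomeoOfIsEmpty N x)
  | succ j ih =>
    have : Nonempty N := (Nat.card_pos_iff.1 (by lia)).1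
    obtain ⟨i⟩ := this
    have hcard : Nat.card {j : N // j ≠ i} = j := by
      have := Nat.card_congr (Equiv.optionSubtypeNe i)
      rw [Finite.card_option] at this
      lia
    let _ : MetricSpace (GenLoop {j : N // j ≠ i} X x) :=
      inferInstanceAs (MetricSpace (Subtype _))
    refine LocallyFillsCubes.of_homeomorph ?_ (GenLoop.loopHomeo i)
    refine LocallyFillsCubes.path (ih ?_ hcard) _ _
    rw [hcard]
    rw [hj] at h
    convert! h using 1
    lia

section WrapBall

variable {E : Type*} [NormedAddCommGroup E] [NormedSpace ℝ E]

/-- A map from the unit ball of `E` onto the unit sphere of `E × ℝ` that collapses the unit sphere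
of `E` to the point `(0, 1)` and is injective elsewhere on the unit ball. -/
noncomputable def wrapBall (z : E) : E × ℝ :=
  ((min 1 (3 * (1 - ‖z‖)) / max ‖z‖ (1 / 3)) • z, max (-1) (min 1 (6 * ‖z‖ - 3)))

theorem continuous_wrapBall : Continuous (wrapBall : E → E × ℝ) := by
  unfold wrapBall
  refine Continuous.prodMk (Continuous.smul (Continuous.div (by fun_prop) (by fun_prop) ?_)
    continuous_id) (by fun_prop)
  intro z
  exact (lt_max_of_lt_right (by norm_num)).ne'

theorem wrapBall_of_norm_le {z : E} (hz : ‖z‖ ≤ 1 / 3) : wrapBall z = ((3 : ℝ) • z, -1) := by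
  unfold wrapBall
  rw [max_eq_right hz, min_eq_left (by linarith),
    max_eq_left (min_le_of_right_le (by linarith))]
  norm_num

theorem wrapBall_of_le_norm_of_norm_le {z : E} (hz : 1 / 3 ≤ ‖z‖) (hz' : ‖z‖ ≤ 2 / 3) :
    wrapBall z = (‖z‖⁻¹ • z, 6 * ‖z‖ - 3) := by
  unfold wrapBall
  rw [max_eq_left hz, min_eq_left (by linarith), min_eq_right (by linarith),
    max_eq_right (by linarith), one_div]

theorem wrapBall_of_le_norm {z : E} (hz : 2 / 3 ≤ ‖z‖) :
    wrapBall z = ((3 * (1 - ‖z‖) / ‖z‖) • z, 1) := by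
  unfold wrapBall
  rw [max_eq_left (by linarith), min_eq_right (by linarith), min_eq_left (by linarith),
    max_eq_right (by norm_num)]

theorem wrapBall_of_norm_eq_one {z : E} (hz : ‖z‖ = 1) : wrapBall z = (0, 1) := by
  rw [wrapBall_of_le_norm (by rw [hz]; norm_num), hz]
  simp

theorem norm_wrapBall {z : E} (hz : ‖z‖ ≤ 1) : ‖wrapBall z‖ = 1 := by
  rcases le_total ‖z‖ (1 / 3) with h | h
  · rw [wrapBall_of_norm_le h, Prod.norm_def, norm_smul]
    simp only [norm_neg, norm_one, Real.norm_ofNat]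
    exact max_eq_right (by linarith)
  rcases le_total ‖z‖ (2 / 3) with h' | h'
  · rw [wrapBall_of_le_norm_of_norm_le h h', Prod.norm_def, norm_smul, norm_inv, norm_norm,
      inv_mul_cancel₀ (by linarith)]
    exact max_eq_left (abs_le.2 ⟨by linarith, by linarith⟩)
  · rw [wrapBall_of_le_norm h', Prod.norm_def, norm_smul, Real.norm_of_nonneg
      (div_nonneg (by linarith) (norm_nonneg z)), div_mul_cancel₀ _ (by linarith), norm_one]
    exact max_eq_right (by linarith)

theorem wrapBall_snd_eq_neg_one_iff {z : E} : (wrapBall z).2 = -1 ↔ ‖z‖ ≤ 1 / 3 := by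
  refine ⟨fun h => ?_, fun h => by rw [wrapBall_of_norm_le h]⟩
  by_contra! hz
  rcases le_total ‖z‖ (2 / 3) with h' | h'
  · rw [wrapBall_of_le_norm_of_norm_le hz.le h'] at h
    dsimp only at h
    linarith
  · rw [wrapBall_of_le_norm h'] at h
    norm_num at h

theorem wrapBall_snd_eq_one_iff {z : E} : (wrapBall z).2 = 1 ↔ 2 / 3 ≤ ‖z‖ := by
  refine ⟨fun h => ?_, fun h => by rw [wrapBall_of_le_norm h]⟩
  by_contra! hz
  rcases le_total ‖z‖ (1 / 3) with h' | h'
  · rw [wrapBall_of_norm_le h'] at h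
    norm_num at h
  · rw [wrapBall_of_le_norm_of_norm_le h' hz.le] at h
    dsimp only at h
    linarith

theorem eq_or_norm_eq_one_of_wrapBall_eq {z z' : E} (hz : ‖z‖ ≤ 1) (hz' : ‖z'‖ ≤ 1)
    (h : wrapBall z = wrapBall z') : z = z' ∨ ‖z‖ = 1 ∧ ‖z'‖ = 1 := by
  rcases le_or_gt ‖z‖ (1 / 3) with h1 | h1
  · have h1' := wrapBall_snd_eq_neg_one_iff.1 (h ▸ wrapBall_snd_eq_neg_one_iff.2 h1)
    rw [wrapBall_of_norm_le h1, wrapBall_of_norm_le h1'] at h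
    exact Or.inl (smul_right_injective E (by norm_num : (3 : ℝ) ≠ 0) (Prod.ext_iff.1 h).1)
  have h1' : 1 / 3 < ‖z'‖ := by
    by_contra! hc
    exact h1.not_ge (wrapBall_snd_eq_neg_one_iff.1 (h ▸ wrapBall_snd_eq_neg_one_iff.2 hc))
  rcases le_or_gt (2 / 3) ‖z‖ with h2 | h2
  · have h2' := wrapBall_snd_eq_one_iff.1 (h ▸ wrapBall_snd_eq_one_iff.2 h2)
    rw [wrapBall_of_le_norm h2, wrapBall_of_le_norm h2'] at h
    have h3 := (Prod.ext_iff.1 h).1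
    dsimp only at h3
    have h4 := congrArg norm h3
    rw [norm_smul, norm_smul, Real.norm_of_nonneg (div_nonneg (by linarith) (norm_nonneg z)),
      Real.norm_of_nonneg (div_nonneg (by linarith) (norm_nonneg z')),
      div_mul_cancel₀ _ (by linarith), div_mul_cancel₀ _ (by linarith)] at h4
    have h5 : ‖z‖ = ‖z'‖ := by linarith
    rcases eq_or_lt_of_le hz with h6 | h6
    · exact Or.inr ⟨h6, h5 ▸ h6⟩
    · rw [← h5] at h3
      exact Or.inl (smul_right_injective E
        (div_pos (by linarith) (by linarith) : 0 < 3 * (1 - ‖z‖) / ‖z‖).ne' h3)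
  · have h2' : ‖z'‖ < 2 / 3 := by
      by_contra! hc
      exact h2.not_ge (wrapBall_snd_eq_one_iff.1 (h ▸ wrapBall_snd_eq_one_iff.2 hc))
    rw [wrapBall_of_le_norm_of_norm_le h1.le h2.le,
      wrapBall_of_le_norm_of_norm_le h1'.le h2'.le] at h
    obtain ⟨h3, h4⟩ := Prod.ext_iff.1 h
    dsimp only at h3 h4
    have h5 : ‖z‖ = ‖z'‖ := by linarith
    rw [← h5] at h3
    exact Or.inl (smul_right_injective E
      (inv_pos.2 (by linarith) : 0 < ‖z‖⁻¹).ne' h3)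

theorem exists_wrapBall_eq [Nontrivial E] {w : E × ℝ} (hw : ‖w‖ = 1) :
    ∃ z : E, ‖z‖ ≤ 1 ∧ wrapBall z = w := by
  obtain ⟨v, s⟩ := w
  have hv : ‖v‖ ≤ 1 := (norm_fst_le (v, s)).trans_eq hw
  have hs : |s| ≤ 1 := (norm_snd_le (v, s)).trans_eq hw
  rw [abs_le] at hs
  rcases eq_or_ne s (-1) with rfl | h1
  · have : ‖(1 / 3 : ℝ) • v‖ ≤ 1 / 3 := by
      rw [norm_smul, Real.norm_of_nonneg (by norm_num)]; linarith
    refine ⟨(1 / 3 : ℝ) • v, by linarith, ?_⟩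
    rw [wrapBall_of_norm_le this, smul_smul]
    norm_num
  rcases eq_or_ne s 1 with rfl | h2
  · rcases eq_or_ne v 0 with rfl | hv0
    · obtain ⟨z, hz⟩ := exists_norm_eq E zero_le_one
      exact ⟨z, hz.le, wrapBall_of_norm_eq_one hz⟩
    · have hvpos : 0 < ‖v‖ := norm_pos_iff.2 hv0
      have hn : ‖((1 - ‖v‖ / 3) / ‖v‖) • v‖ = 1 - ‖v‖ / 3 := by
        rw [norm_smul, Real.norm_of_nonneg (div_nonneg (by linarith) hvpos.le),
          div_mul_cancel₀ _ hvpos.ne']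
      refine ⟨((1 - ‖v‖ / 3) / ‖v‖) • v, by rw [hn]; linarith, ?_⟩
      rw [wrapBall_of_le_norm (by rw [hn]; linarith), hn, smul_smul]
      have h3 : 1 - ‖v‖ / 3 ≠ 0 := by linarith
      have : 3 * (1 - (1 - ‖v‖ / 3)) / (1 - ‖v‖ / 3) * ((1 - ‖v‖ / 3) / ‖v‖) = 1 := by
        rw [div_mul_div_cancel₀ h3]
        field_simp
        ring
      rw [this, one_smul]
  · have hs1 : |s| < 1 := abs_lt.2 ⟨lt_of_le_of_ne hs.1 h1.symm, lt_of_le_of_ne hs.2 h2⟩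
    have hv1 : ‖v‖ = 1 := by
      rcases max_choice ‖v‖ ‖s‖ with h | h
      · rw [← h]; exact hw
      · rw [Prod.norm_def] at hw
        dsimp only at hw
        rw [h, Real.norm_eq_abs] at hw
        exact absurd hw hs1.ne
    have hn : ‖((s + 3) / 6) • v‖ = (s + 3) / 6 := by
      rw [norm_smul, hv1, mul_one, Real.norm_of_nonneg (by linarith)]
    refine ⟨((s + 3) / 6) • v, by rw [hn]; linarith, ?_⟩
    rw [wrapBall_of_le_norm_of_norm_le (by rw [hn]; linarith) (by rw [hn]; linarith), hn,
      smul_smul, inv_mul_cancel₀ (by linarith), one_smul]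
    exact Prod.ext rfl (by ring)

end WrapBall

namespace Cube

/-- The embedding of the cube onto the unit ball of the sup norm. -/
def toBall {k : ℕ} (u : Fin k → I) : Fin k → ℝ := fun i => 2 * (u i : ℝ) - 1

theorem abs_two_mul_sub_one_le (t : I) : |2 * (t : ℝ) - 1| ≤ 1 :=
  abs_le.2 ⟨by linarith [t.2.1], by linarith [t.2.2]⟩

theorem abs_two_mul_sub_one_eq_one_iff {t : I} : |2 * (t : ℝ) - 1| = 1 ↔ t = 0 ∨ t = 1 := by
  rw [abs_eq zero_le_one, or_comm]
  simp only [Subtype.ext_iff, Icc.coe_zero, Icc.coe_one]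
  constructor <;> rintro (h | h)
  · left; linarith
  · right; linarith
  · left; linarith
  · right; linarith

theorem continuous_toBall {k : ℕ} : Continuous (toBall (k := k)) := by
  unfold toBall; fun_prop

theorem toBall_injective {k : ℕ} : Function.Injective (toBall (k := k)) := by
  intro u u' h
  ext i
  have := congrFun h i
  simp only [toBall] at this
  linarith

theorem norm_toBall_le {k : ℕ} (u : Fin k → I) : ‖toBall u‖ ≤ 1 :=
  (pi_norm_le_iff_of_nonneg zero_le_one).2 fun i => abs_two_mul_sub_one_le (u i)

theorem exists_toBall_eq {k : ℕ} {v : Fin k → ℝ} (hv : ‖v‖ ≤ 1) : ∃ u, toBall u = v := by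
  have h : ∀ i, |v i| ≤ 1 := fun i => (norm_le_pi_norm v i).trans hv
  refine ⟨fun i => ⟨(v i + 1) / 2, by linarith [(abs_le.1 (h i)).1],
    by linarith [(abs_le.1 (h i)).2]⟩, ?_⟩
  ext i
  simp only [toBall]
  ring

theorem mem_boundary_iff_norm_toBall {k : ℕ} {u : Fin k → I} :
    u ∈ Cube.boundary (Fin k) ↔ ‖toBall u‖ = 1 := by
  constructor
  · rintro ⟨i, hi⟩
    refine le_antisymm (norm_toBall_le u) ?_
    rw [← abs_two_mul_sub_one_eq_one_iff.2 hi]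
    exact norm_le_pi_norm (toBall u) i
  · intro h
    by_contra hu
    refine h.not_lt ((pi_norm_lt_iff zero_lt_one).2 fun i => ?_)
    exact lt_of_le_of_ne (abs_two_mul_sub_one_le (u i)) fun hi =>
      hu ⟨i, abs_two_mul_sub_one_eq_one_iff.1 hi⟩

/-- The inverse of the identification of a cube with the unit ball of a product. -/
noncomputable def ofBallProd {k : ℕ} (w : (Fin k → ℝ) × ℝ) : Fin (k + 1) → I :=
  Fin.cons (projIcc 0 1 zero_le_one ((w.2 + 1) / 2))
    fun i => projIcc 0 1 zero_le_one ((w.1 i + 1) / 2)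

theorem continuous_ofBallProd {k : ℕ} : Continuous (ofBallProd (k := k)) := by
  refine Continuous.finCons (continuous_projIcc.comp (by fun_prop)) ?_
  exact continuous_pi fun i => continuous_projIcc.comp (by fun_prop)

theorem toBall_ofBallProd {k : ℕ} {w : (Fin k → ℝ) × ℝ} (hw : ‖w‖ ≤ 1) :
    toBall (ofBallProd w) = Fin.cons w.2 w.1 := by
  have h1 : ∀ i, |w.1 i| ≤ 1 := fun i => (norm_le_pi_norm w.1 i).trans ((norm_fst_le w).trans hw)
  have h2 : |w.2| ≤ 1 := (norm_snd_le w).trans hw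
  have key : ∀ s : ℝ, |s| ≤ 1 → 2 * (projIcc (0 : ℝ) 1 zero_le_one ((s + 1) / 2) : ℝ) - 1 = s := by
    intro s hs
    rw [abs_le] at hs
    rw [projIcc_of_mem zero_le_one ⟨by linarith, by linarith⟩]
    ring
  ext i
  refine Fin.cases ?_ (fun i => ?_) i
  · exact key _ h2
  · exact key _ (h1 i)

theorem norm_finCons {k : ℕ} (s : ℝ) (v : Fin k → ℝ) :
    ‖(Fin.cons s v : Fin (k + 1) → ℝ)‖ = ‖(v, s)‖ := by
  refine le_antisymm ?_ (norm_prod_le_iff.2 ⟨?_, ?_⟩)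
  · refine (pi_norm_le_iff_of_nonneg (norm_nonneg _)).2 fun i => ?_
    refine Fin.cases ?_ (fun i => ?_) i
    · exact norm_snd_le (v, s)
    · exact (norm_le_pi_norm v i).trans (norm_fst_le (v, s))
  · refine (pi_norm_le_iff_of_nonneg (norm_nonneg _)).2 fun i => ?_
    exact norm_le_pi_norm (Fin.cons s v : Fin (k + 1) → ℝ) i.succ
  · exact norm_le_pi_norm (Fin.cons s v : Fin (k + 1) → ℝ) 0

theorem ofBallProd_mem_boundary {k : ℕ} {w : (Fin k → ℝ) × ℝ} (hw : ‖w‖ ≤ 1) :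
    ofBallProd w ∈ Cube.boundary (Fin (k + 1)) ↔ ‖w‖ = 1 := by
  rw [mem_boundary_iff_norm_toBall, toBall_ofBallProd hw, norm_finCons]

theorem ofBallProd_injOn {k : ℕ} :
    InjOn (ofBallProd (k := k)) {w | ‖w‖ ≤ 1} := by
  intro w hw w' hw' h
  have := congrArg toBall h
  rw [toBall_ofBallProd hw, toBall_ofBallProd hw'] at this
  obtain ⟨h1, h2⟩ := Fin.cons_inj.1 this
  exact Prod.ext h2 h1

theorem exists_ofBallProd_eq {k : ℕ} (u : Fin (k + 1) → I) :
    ∃ w : (Fin k → ℝ) × ℝ, ‖w‖ ≤ 1 ∧ ofBallProd w = u := by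
  have hw : ‖((Fin.tail (toBall u), toBall u 0) : (Fin k → ℝ) × ℝ)‖ ≤ 1 := by
    rw [← norm_finCons, Fin.cons_self_tail]
    exact norm_toBall_le u
  refine ⟨_, hw, toBall_injective ?_⟩
  rw [toBall_ofBallProd hw, Fin.cons_self_tail]

/-- The map from the cylinder over a cube onto the cube of one dimension more that wraps the base
of the cylinder around the boundary and collapses the top to the center. -/
noncomputable def cone {k : ℕ} (z : I × (Fin k → I)) : Fin (k + 1) → I :=
  ofBallProd ((1 - (z.1 : ℝ)) • wrapBall (toBall z.2))

theorem continuous_cone {k : ℕ} : Continuous (cone (k := k)) :=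
  continuous_ofBallProd.comp ((continuous_const.sub
    (continuous_subtype_val.comp continuous_fst)).smul (continuous_wrapBall.comp (continuous_toBall.comp continuous_snd)))

theorem norm_smul_wrapBall_toBall {k : ℕ} (z : I × (Fin k → I)) :
    ‖(1 - (z.1 : ℝ)) • wrapBall (toBall z.2)‖ = 1 - z.1 := by
  rw [norm_smul, norm_wrapBall (norm_toBall_le _), mul_one,
    Real.norm_of_nonneg (by linarith [z.1.2.2])]

theorem cone_mem_boundary {k : ℕ} {z : I × (Fin k → I)} :
    cone z ∈ Cube.boundary (Fin (k + 1)) ↔ z.1 = 0 := by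
  have h := norm_smul_wrapBall_toBall z
  rw [cone, ofBallProd_mem_boundary (h.le.trans (by linarith [z.1.2.1])), h, Subtype.ext_iff]
  simp

theorem cone_surjective {k : ℕ} (hk : k ≠ 0) : Function.Surjective (cone (k := k)) := by
  intro u
  have : NeZero k := ⟨hk⟩
  obtain ⟨w, hw, rfl⟩ := exists_ofBallProd_eq u
  obtain ⟨w', hw', h⟩ : ∃ w' : (Fin k → ℝ) × ℝ, ‖w'‖ = 1 ∧ ‖w‖ • w' = w := by
    rcases eq_or_ne w 0 with rfl | h0
    · exact ⟨(0, 1), by simp [Prod.norm_def], by simp⟩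
    · exact ⟨‖w‖⁻¹ • w, by simp [norm_smul, norm_ne_zero_iff.2 h0],
        by simp [smul_smul, norm_ne_zero_iff.2 h0]⟩
  obtain ⟨v, hv, rfl⟩ := exists_wrapBall_eq hw'
  obtain ⟨t, rfl⟩ := exists_toBall_eq hv
  refine ⟨(⟨1 - ‖w‖, by linarith, by linarith [norm_nonneg w]⟩, t), ?_⟩
  simp [cone, h]

theorem eq_of_cone_eq {k : ℕ} {z z' : I × (Fin k → I)} (h : cone z = cone z') :
    z = z' ∨ (z.1 = 1 ∧ z'.1 = 1) ∨
      z.2 ∈ Cube.boundary (Fin k) ∧ z'.2 ∈ Cube.boundary (Fin k) := by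
  have hn := norm_smul_wrapBall_toBall z
  have hn' := norm_smul_wrapBall_toBall z'
  have h1 := ofBallProd_injOn (hn.le.trans (by linarith [z.1.2.1]))
    (hn'.le.trans (by linarith [z'.1.2.1])) h
  have h2 : (z.1 : ℝ) = z'.1 := by
    rw [h1, hn'] at hn
    linarith
  rcases eq_or_ne z.1 1 with h3 | h3
  · exact Or.inr (Or.inl ⟨h3, (Subtype.ext h2).symm.trans h3⟩)
  have h4 : (1 - (z.1 : ℝ)) ≠ 0 := by
    intro h5
    exact h3 (Subtype.ext (by simp only [Icc.coe_one]; linarith))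
  rw [← h2] at h1
  rcases eq_or_norm_eq_one_of_wrapBall_eq (norm_toBall_le _) (norm_toBall_le _)
    (smul_right_injective _ h4 h1) with h5 | h5
  · exact Or.inl (Prod.ext (Subtype.ext h2) (toBall_injective h5))
  · exact Or.inr (Or.inr ⟨mem_boundary_iff_norm_toBall.2 h5.1,
      mem_boundary_iff_norm_toBall.2 h5.2⟩)

theorem cone_zero_of_mem_boundary {k : ℕ} {t : Fin k → I} (ht : t ∈ Cube.boundary (Fin k)) :
    cone (0, t) = ofBallProd (0, 1) := by
  simp [cone, wrapBall_of_norm_eq_one (mem_boundary_iff_norm_toBall.1 ht)]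

end Cube

theorem LocallyNConnected.locallyFillsCubes {n : ℕ} {X : Type*} [TopologicalSpace X]
    (h : LocallyNConnected n X) : LocallyFillsCubes n X := by
  intro x U hU
  obtain ⟨W, hWU, hW, hxW⟩ := mem_nhds_iff.1 hU
  obtain ⟨V, hV, hxV, -, hnull⟩ := h x W hW hxW
  refine ⟨V, hV.mem_nhds hxV, fun k hk φ hφ hφV => ?_⟩
  rcases eq_or_ne k 0 with rfl | hk0
  · obtain ⟨H, hH⟩ := hnull 0 hk (φ 1) (hφV ⟨0, Or.inr rfl⟩)
      ⟨.const _ (φ 0), by rintro u ⟨i, -⟩; exact i.elim0⟩ fun t => hφV ⟨0, Or.inl rfl⟩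
    refine ⟨⟨fun u => H (u 0, Fin.elim0), by fun_prop⟩, ?_, fun u => hWU (hH _)⟩
    intro u hu
    rcases Cube.eq_zero_or_eq_one_of_mem_boundary hu with rfl | rfl
    · exact H.apply_zero _
    · exact H.apply_one _
  have hmem : ∀ t : Fin k → I, Cube.cone (0, t) ∈ Cube.boundary (Fin (k + 1)) :=
    fun t => Cube.cone_mem_boundary.2 rfl
  have hbase : Cube.ofBallProd (0, 1) ∈ Cube.boundary (Fin (k + 1)) :=
    (Cube.ofBallProd_mem_boundary (by simp [Prod.norm_def])).2 (by simp [Prod.norm_def])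
  obtain ⟨H, hH⟩ := hnull k hk (φ (Cube.ofBallProd (0, 1))) (hφV hbase)
    ⟨⟨fun t => φ (Cube.cone (0, t)),
      hφ.comp_continuous (Cube.continuous_cone.comp (by fun_prop)) hmem⟩,
      fun t ht => congrArg φ (Cube.cone_zero_of_mem_boundary ht)⟩ fun t => hφV (hmem t)
  have hHb : ∀ s, ∀ t ∈ Cube.boundary (Fin k), H (s, t) = φ (Cube.ofBallProd (0, 1)) :=
    fun s t ht => H.eq_snd s ht
  have hquot : Topology.IsQuotientMap (Cube.cone (k := k)) :=
    Cube.continuous_cone.isClosedMap.isQuotientMap Cube.continuous_cone (Cube.cone_surjective hk0)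
  have hfac : Function.FactorsThrough H (Cube.cone (k := k)) := by
    rintro ⟨s, t⟩ ⟨s', t'⟩ hst
    rcases Cube.eq_of_cone_eq hst with h1 | ⟨h1, h2⟩ | ⟨h1, h2⟩
    · rw [h1]
    · dsimp only at h1 h2
      subst h1 h2
      exact (H.apply_one t).trans (H.apply_one t').symm
    · exact (hHb s t h1).trans (hHb s' t' h2).symm
  let G := Topology.IsQuotientMap.lift (f := ⟨Cube.cone, Cube.continuous_cone⟩) hquot H.toContinuousMap hfac
  have hG : ∀ z, G (Cube.cone z) = H z := fun z =>
    DFunLike.congr_fun (Topology.IsQuotientMap.lift_comp (f := ⟨Cube.cone, Cube.continuous_cone⟩) hquot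
      H.toContinuousMap hfac) z
  refine ⟨G, fun u hu => ?_, fun u => ?_⟩
  · obtain ⟨⟨s, t⟩, rfl⟩ := Cube.cone_surjective hk0 u
    obtain rfl : s = 0 := Cube.cone_mem_boundary.1 hu
    rw [hG]
    exact H.apply_zero t
  · obtain ⟨z, rfl⟩ := Cube.cone_surjective hk0 u
    rw [hG]
    exact hWU (hH z)

/-- The n-th topological homotopy group of a locally n-connected metric space is
discrete; equivalently, the path components of the based n-loop space are open. -/
theorem locallyNConnected_discrete (X : Type*) [MetricSpace X] (n : ℕ) (hn : 1 ≤ n)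
    (h : LocallyNConnected n X) (x : X) :
    DiscreteTopology (HomotopyGroup (Fin n) X x) ∧
      ∀ p : GenLoop (Fin n) X x, IsOpen (pathComponent p) := by
  have hopen : ∀ p : GenLoop (Fin n) X x, IsOpen (pathComponent p) :=
    isOpen_pathComponent_of_joined_nhds (LocallyFillsCubes.joined_nhds
      (LocallyFillsCubes.genLoop (by simpa using h.locallyFillsCubes) x))
  refine ⟨discreteTopology_iff_forall_isOpen.2 fun S => ?_, hopen⟩
  refine isQuotientMap_quotient_mk'.isOpen_preimage.1 (isOpen_iff_mem_nhds.2 fun p hp => ?_)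
  filter_upwards [(hopen p).mem_nhds (mem_pathComponent_self p)] with q hq
  have : (Quotient.mk' p : HomotopyGroup (Fin n) X x) = Quotient.mk' q :=
    Quotient.sound (GenLoop.homotopic_of_joined hq)
  exact (congrArg (· ∈ S) this).mp hp
end

section
/- Let X = ⋃_{n ∈ ℕ} S_n ⊆ ℝ³ where S_n is the sphere of radius 1/n centered at (1/n, 0, 0) (all spheres passing through the origin). Then π_1(X, 0) is trivial, but π_2^top(X, 0) is not discrete: the classes [S_n] of the canonical 2-loops parametrizing S_n converge to the identity element in π_2^top(X, 0) while being distinct from it. -/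
open scoped unitInterval Topology
open Set Filter

/-- The center (1/(n+1), 0, 0) of the n-th sphere of the 2-dimensional Hawaiian
earring. -/
noncomputable def hawaiianCenter (n : ℕ) : EuclideanSpace ℝ (Fin 3) :=
  (EuclideanSpace.equiv (Fin 3) ℝ).symm ![1 / (n + 1), 0, 0]

/-- The 2-dimensional Hawaiian earring: the union of the spheres of radius 1/(n+1)
centered at (1/(n+1), 0, 0), all passing through the origin. -/
noncomputable def hawaiianEarring2 : Set (EuclideanSpace ℝ (Fin 3)) :=
  ⋃ n : ℕ, Metric.sphere (hawaiianCenter n) (1 / (n + 1))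

/-- A continuous path in the plane is uniformly close to one that avoids the origin. -/
theorem exists_continuous_ne_zero_near {g : I → ℂ} (hg : Continuous g) {ε : ℝ} (hε : 0 < ε) :
    ∃ q : I → ℂ, Continuous q ∧ (∀ t, ‖q t - g t‖ < ε) ∧ ∀ t, q t ≠ 0 := by
  obtain ⟨p₁, hp₁⟩ := exists_polynomial_near_of_continuousOn 0 1
    (fun t => (g (projIcc 0 1 zero_le_one t)).re) (by fun_prop) (ε / 3) (by positivity)
  obtain ⟨p₂, hp₂⟩ := exists_polynomial_near_of_continuousOn 0 1
    (fun t => (g (projIcc 0 1 zero_le_one t)).im) (by fun_prop) (ε / 3) (by positivity)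
  let r : ℝ → ℂ := fun t => ((p₁.eval t : ℝ) : ℂ) + ((p₂.eval t : ℝ) : ℂ) * Complex.I
  have hr : ContDiff ℝ 1 r := by
    have hp (p : Polynomial ℝ) : ContDiff ℝ 1 fun t : ℝ => ((p.eval t : ℝ) : ℂ) :=
      Complex.ofRealCLM.contDiff.comp (by simpa using p.contDiff_aeval (𝕜 := ℝ) 1)
    exact (hp p₁).add ((hp p₂).mul contDiff_const)
  have hdense : Dense (range r)ᶜ :=
    hr.dense_compl_range_of_finrank_lt_finrank (by simp [Complex.finrank_real_complex])
  obtain ⟨c, hc, hcε⟩ := hdense.exists_dist_lt 0 (show 0 < ε / 3 by positivity)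
  rw [dist_zero_left] at hcε
  refine ⟨fun t => r t - c, (hr.continuous.comp continuous_subtype_val).sub continuous_const,
    fun t => ?_, fun t ht => hc ⟨t, sub_eq_zero.mp ht⟩⟩
  have h₁ := hp₁ t t.2
  have h₂ := hp₂ t t.2
  simp only [projIcc_val] at h₁ h₂
  have hrg : ‖r t - g t‖ ≤ |p₁.eval (t : ℝ) - (g t).re| + |p₂.eval (t : ℝ) - (g t).im| := by
    simpa [r] using Complex.norm_le_abs_re_add_abs_im (r t - g t)
  calc ‖r t - c - g t‖ = ‖(r t - g t) - c‖ := by ring_nf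
    _ ≤ ‖r t - g t‖ + ‖c‖ := norm_sub_le _ _
    _ < ε := by linarith

/-- No nonvanishing continuous function on the plane agrees with a constant multiple of `z⁻¹` on
the boundary of the square `[-1, 1]²`. -/
theorem not_continuous_ne_zero_of_mul_eq_const {Λ : ℂ → ℂ} (hΛ : Continuous Λ)
    (hne : ∀ z, Λ z ≠ 0) {c : ℂ} (h : ∀ z : ℂ, max |z.re| |z.im| = 1 → Λ z * z = c) : False := by
  obtain ⟨L, ⟨-, hL⟩, -⟩ := Complex.isCoveringMapOn_exp.existsUnique_continuousMap_lifts
    ⟨Λ, hΛ⟩ (a₀ := 0) (Complex.exp_log (hne 0)) (fun a => hne a)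
  have hL' : ∀ z, Complex.exp (L z) = Λ z := fun z => congrFun hL z
  let ρ : ℝ → ℝ := fun θ => max |Real.cos θ| |Real.sin θ|
  have hρ : ∀ θ, 0 < ρ θ := fun θ => by
    rcases eq_or_ne (Real.cos θ) 0 with h0 | h0
    · refine lt_max_of_lt_right (abs_pos.mpr fun h1 => ?_)
      have := Real.sin_sq_add_cos_sq θ
      simp [h0, h1] at this
    · exact lt_max_of_lt_left (abs_pos.mpr h0)
  have hρc : Continuous ρ := by fun_prop
  let β : ℝ → ℂ := fun θ => Complex.exp (θ * Complex.I) / (ρ θ : ℂ)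
  have hβc : Continuous β := by
    refine Continuous.div (by fun_prop) (by fun_prop) fun θ => ?_
    exact_mod_cast (hρ θ).ne'
  have hβ : ∀ θ, Λ (β θ) * β θ = c := fun θ => by
    refine h _ ?_
    have hre : (β θ).re = Real.cos θ / ρ θ := by
      simp [β, Complex.div_ofReal_re, Complex.exp_ofReal_mul_I_re]
    have him : (β θ).im = Real.sin θ / ρ θ := by
      simp [β, Complex.div_ofReal_im, Complex.exp_ofReal_mul_I_im]
    rw [hre, him, abs_div, abs_div, abs_of_pos (hρ θ), max_div_div_right (hρ θ).le]
    exact div_self (hρ θ).ne'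
  let u : ℝ → ℂ := fun θ => L (β θ) + θ * Complex.I - (Real.log (ρ θ) : ℂ)
  have huc : Continuous u := by
    have : Continuous fun θ => Real.log (ρ θ) := hρc.log fun θ => (hρ θ).ne'
    fun_prop
  have hu : ∀ θ, Complex.exp (u θ) = c := fun θ => by
    rw [← hβ θ]
    simp only [u, Complex.exp_sub, Complex.exp_add, hL', ← Complex.ofReal_exp,
      Real.exp_log (hρ θ), β, mul_div_assoc]
  have hconst := Complex.isCoveringMap_exp.const_of_comp huc
    (fun a a' => Subtype.ext ((hu a).trans (hu a').symm)) 0 (2 * Real.pi)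
  have hβ2 : β (2 * Real.pi) = β 0 := by simp [β, ρ, Complex.exp_two_pi_mul_I]
  have hρ2 : ρ (2 * Real.pi) = ρ 0 := by simp [ρ]
  simp only [u, hβ2, hρ2] at hconst
  have := congrArg Complex.im hconst
  simp [Real.pi_ne_zero] at this

/-- A nonzero vector can be transported along a homotopy of idempotents, and the transport is
trivial over the points where the vector stays fixed. -/
theorem exists_continuous_fixed_of_idempotent {K E : Type*} [PseudoMetricSpace K] [CompactSpace K]
    [NormedAddCommGroup E] [NormedSpace ℂ E] {P : I × K → E →L[ℂ] E} (hP : Continuous P)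
    (hidem : ∀ y v, P y (P y v) = P y v) {v₀ : E} (hv₀ : v₀ ≠ 0)
    (h₀ : ∀ x, P (0, x) v₀ = v₀) :
    ∃ G : K → E, Continuous G ∧ (∀ x, G x ≠ 0) ∧ (∀ x, P (1, x) (G x) = G x) ∧
      ∀ x, (∀ t, P (t, x) v₀ = v₀) → G x = v₀ := by
  obtain ⟨δ, hδ, hPδ⟩ := Metric.uniformContinuous_iff.mp
    (CompactSpace.uniformContinuous_of_continuous hP) 1 one_pos
  obtain ⟨N, hN⟩ := exists_nat_one_div_lt hδ
  let τ : ℕ → I := fun j => projIcc 0 1 zero_le_one ((j : ℝ) / (N + 1))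
  have hτ : ∀ j, dist (τ (j + 1)) (τ j) < δ := fun j => by
    refine lt_of_le_of_lt ?_ hN
    rw [Subtype.dist_eq, Real.dist_eq]
    refine (abs_projIcc_sub_projIcc zero_le_one).trans_eq ?_
    rw [← sub_div, Nat.cast_succ, add_sub_cancel_left, abs_of_pos (by positivity)]
  have key : ∀ j, ∃ G : K → E, Continuous G ∧ (∀ x, G x ≠ 0) ∧
      (∀ x, P (τ j, x) (G x) = G x) ∧ ∀ x, (∀ t, P (t, x) v₀ = v₀) → G x = v₀ := by
    intro j
    induction j with
    | zero =>
      refine ⟨fun _ => v₀, continuous_const, fun _ => hv₀, fun x => ?_, fun _ _ => rfl⟩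
      have : τ 0 = 0 := by simp [τ, projIcc_left]
      rw [this, h₀]
    | succ j ih =>
      obtain ⟨G, hGc, hG0, hGP, hGv⟩ := ih
      refine ⟨fun x => P (τ (j + 1), x) (G x), ?_, fun x hx => ?_, fun x => hidem _ _,
        fun x hx => by simp only [hGv x hx, hx]⟩
      · exact (hP.comp (by fun_prop)).clm_apply hGc
      · beta_reduce at hx
        have hd : dist (P (τ (j + 1), x)) (P (τ j, x)) < 1 := by
          refine hPδ ?_
          simpa [Prod.dist_eq, hδ] using hτ j
        have hle := ((P (τ (j + 1), x)) - P (τ j, x)).le_opNorm (G x)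
        rw [sub_apply, hx, hGP, zero_sub, norm_neg] at hle
        rw [dist_eq_norm] at hd
        have := norm_pos_iff.mpr (hG0 x)
        nlinarith
  have hτ1 : τ (N + 1) = 1 := by
    have : ((N + 1 : ℕ) : ℝ) / (N + 1) = 1 := by
      rw [Nat.cast_succ]; exact div_self (by positivity)
    simp only [τ, this, projIcc_right]
    rfl
  simpa only [hτ1] using key (N + 1)

theorem mem_sphere_hawaiianCenter_iff {n : ℕ} {x : EuclideanSpace ℝ (Fin 3)} :
    x ∈ Metric.sphere (hawaiianCenter n) (1 / (n + 1)) ↔ (n + 1) * ‖x‖ ^ 2 = 2 * x 0 := by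
  have hn : (0 : ℝ) < n + 1 := by positivity
  rw [mem_sphere_iff_norm, ← sq_eq_sq₀ (norm_nonneg _) (by positivity)]
  simp only [EuclideanSpace.real_norm_sq_eq, Fin.sum_univ_three, hawaiianCenter]
  simp
  field_simp
  constructor <;> intro h
  · exact mul_left_cancel₀ hn.ne' (by linear_combination h)
  · linear_combination (n + 1) * h

theorem norm_sq_of_mem_sphere {n : ℕ} {x : EuclideanSpace ℝ (Fin 3)}
    (hx : x ∈ Metric.sphere (hawaiianCenter n) (1 / (n + 1))) :
    ‖x‖ ^ 2 = 2 / (n + 1) * x 0 := by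
  have hn : (0 : ℝ) < n + 1 := by positivity
  have := mem_sphere_hawaiianCenter_iff.mp hx
  field_simp
  linarith

/-- Homogeneous coordinates on the `n`-th sphere: the image of the point of `ℂP¹` with
coordinates `[w : m]`, the origin corresponding to `m = 0`. -/
noncomputable def hawaiianPoint (n : ℕ) (m : ℝ) (w : ℂ) : EuclideanSpace ℝ (Fin 3) :=
  (2 / ((n + 1) * (m ^ 2 + ‖w‖ ^ 2))) • !₂[m ^ 2, m * w.re, m * w.im]

theorem hawaiianPoint_zero (n : ℕ) (w : ℂ) : hawaiianPoint n 0 w = 0 := by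
  ext i
  fin_cases i <;> simp [hawaiianPoint]

theorem norm_sq_hawaiianPoint (n : ℕ) (m : ℝ) (w : ℂ) :
    ‖hawaiianPoint n m w‖ ^ 2 = (2 / (n + 1)) ^ 2 * (m ^ 2 / (m ^ 2 + ‖w‖ ^ 2)) := by
  rcases eq_or_ne (m ^ 2 + ‖w‖ ^ 2) 0 with h | h
  · have hm : m = 0 := by nlinarith [sq_nonneg m, sq_nonneg ‖w‖]
    simp [hm, hawaiianPoint_zero]
  have hn : (0 : ℝ) < n + 1 := by positivity
  have hw : ‖w‖ ^ 2 = w.re ^ 2 + w.im ^ 2 := by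
    rw [← Complex.normSq_eq_norm_sq, Complex.normSq_apply]; ring
  rw [hw] at h
  simp only [EuclideanSpace.real_norm_sq_eq, Fin.sum_univ_three, hawaiianPoint, hw]
  simp
  field_simp
  ring

theorem hawaiianPoint_mem_sphere (n : ℕ) (m : ℝ) (w : ℂ) :
    hawaiianPoint n m w ∈ Metric.sphere (hawaiianCenter n) (1 / (n + 1)) := by
  rw [mem_sphere_hawaiianCenter_iff, norm_sq_hawaiianPoint]
  have hn : (0 : ℝ) < n + 1 := by positivity
  simp only [hawaiianPoint, PiLp.smul_apply, smul_eq_mul]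
  simp
  field_simp

theorem hawaiianPoint_mem (n : ℕ) (m : ℝ) (w : ℂ) : hawaiianPoint n m w ∈ hawaiianEarring2 :=
  mem_iUnion.mpr ⟨n, hawaiianPoint_mem_sphere n m w⟩

theorem norm_hawaiianPoint_le (n : ℕ) (m : ℝ) (w : ℂ) :
    ‖hawaiianPoint n m w‖ ≤ 2 / (n + 1) := by
  refine (sq_le_sq₀ (norm_nonneg _) (by positivity)).mp ?_
  rw [norm_sq_hawaiianPoint]
  refine mul_le_of_le_one_right (by positivity) (div_le_one_of_le₀ ?_ (by positivity))
  nlinarith [sq_nonneg ‖w‖]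

theorem ContinuousAt.hawaiianPoint {T : Type*} [TopologicalSpace T] {n : ℕ} {m : T → ℝ}
    {w : T → ℂ} {t : T} (hm : ContinuousAt m t) (hw : ContinuousAt w t)
    (h : m t ^ 2 + ‖w t‖ ^ 2 ≠ 0) : ContinuousAt (fun t => hawaiianPoint n (m t) (w t)) t := by
  have hn : (n + 1 : ℝ) ≠ 0 := by positivity
  refine ContinuousAt.smul (f := fun t => 2 / ((n + 1) * (m t ^ 2 + ‖w t‖ ^ 2)))
    (g := fun t => !₂[m t ^ 2, m t * (w t).re, m t * (w t).im]) ?_ ?_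
  · exact continuousAt_const.div (by fun_prop) (mul_ne_zero hn h)
  · refine (PiLp.continuous_toLp 2 _).continuousAt.comp (continuousAt_pi.mpr fun i => ?_)
    have hre := Complex.continuous_re.continuousAt.comp hw
    have him := Complex.continuous_im.continuousAt.comp hw
    fin_cases i
    · exact hm.pow 2
    · exact hm.mul hre
    · exact hm.mul him

open Classical in
/-- The homogeneous coordinates of a point of the earring on the `n`-th sphere, and `0` away
from that sphere. -/
noncomputable def hawaiianCoord (n : ℕ) (x : hawaiianEarring2) : ℝ × ℂ :=
  if (x : EuclideanSpace ℝ (Fin 3)) ∈ Metric.sphere (hawaiianCenter n) (1 / (n + 1)) then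
    ((n + 1) / 2 * x.1 0, ((n + 1) / 2 : ℝ) * (⟨x.1 1, x.1 2⟩ : ℂ))
  else 0

theorem hawaiianCoord_of_mem {n : ℕ} {x : hawaiianEarring2}
    (hx : (x : EuclideanSpace ℝ (Fin 3)) ∈ Metric.sphere (hawaiianCenter n) (1 / (n + 1))) :
    hawaiianCoord n x =
      ((n + 1) / 2 * x.1 0, ((n + 1) / 2 : ℝ) * (⟨x.1 1, x.1 2⟩ : ℂ)) :=
  if_pos hx

theorem hawaiianCoord_of_notMem {n : ℕ} {x : hawaiianEarring2}
    (hx : (x : EuclideanSpace ℝ (Fin 3)) ∉ Metric.sphere (hawaiianCenter n) (1 / (n + 1))) :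
    hawaiianCoord n x = 0 :=
  if_neg hx

theorem hawaiianCoord_zero {n : ℕ} {x : hawaiianEarring2}
    (hx : (x : EuclideanSpace ℝ (Fin 3)) = 0) : hawaiianCoord n x = 0 := by
  unfold hawaiianCoord
  split_ifs
  · have : (⟨0, 0⟩ : ℂ) = 0 := rfl
    simp [hx, this]
  · rfl

theorem hawaiianCoord_fst_eq {n : ℕ} {x : hawaiianEarring2}
    (hx : (x : EuclideanSpace ℝ (Fin 3)) ∈ Metric.sphere (hawaiianCenter n) (1 / (n + 1))) :
    ‖(x : EuclideanSpace ℝ (Fin 3))‖ ^ 2 = (2 / (n + 1)) ^ 2 * (hawaiianCoord n x).1 := by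
  have hn : (0 : ℝ) < n + 1 := by positivity
  rw [hawaiianCoord_of_mem hx, norm_sq_of_mem_sphere hx]
  field_simp

theorem norm_sq_hawaiianCoord_snd (n : ℕ) (x : hawaiianEarring2) :
    ‖(hawaiianCoord n x).2‖ ^ 2 = (hawaiianCoord n x).1 - (hawaiianCoord n x).1 ^ 2 := by
  by_cases hx : (x : EuclideanSpace ℝ (Fin 3)) ∈
    Metric.sphere (hawaiianCenter n) (1 / (n + 1))
  · have h := mem_sphere_hawaiianCenter_iff.mp hx
    rw [EuclideanSpace.real_norm_sq_eq, Fin.sum_univ_three] at h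
    rw [hawaiianCoord_of_mem hx, norm_mul, mul_pow, Complex.norm_real, Real.norm_eq_abs, sq_abs,
      ← Complex.normSq_eq_norm_sq, Complex.normSq_mk]
    linear_combination (n + 1) / 4 * h
  · simp [hawaiianCoord_of_notMem hx]

theorem hawaiianCoord_fst_mem_Icc (n : ℕ) (x : hawaiianEarring2) :
    (hawaiianCoord n x).1 ∈ Icc (0 : ℝ) 1 := by
  have := norm_sq_hawaiianCoord_snd n x
  constructor <;> nlinarith [sq_nonneg ‖(hawaiianCoord n x).2‖]

theorem hawaiianPoint_hawaiianCoord {n : ℕ} {x : hawaiianEarring2}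
    (hx : (x : EuclideanSpace ℝ (Fin 3)) ∈ Metric.sphere (hawaiianCenter n) (1 / (n + 1))) :
    hawaiianPoint n (hawaiianCoord n x).1 (hawaiianCoord n x).2 = x := by
  have hn : (0 : ℝ) < n + 1 := by positivity
  have hnorm := hawaiianCoord_fst_eq hx
  rcases eq_or_ne (hawaiianCoord n x).1 0 with h0 | h0
  · rw [h0, hawaiianPoint_zero]
    rw [h0, mul_zero, sq_eq_zero_iff, norm_eq_zero] at hnorm
    exact hnorm.symm
  · unfold hawaiianPoint
    rw [norm_sq_hawaiianCoord_snd, add_sub_cancel]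
    rw [hawaiianCoord_of_mem hx] at h0 ⊢
    have hx0 : x.1 0 ≠ 0 := fun h => h0 (by simp [h])
    ext i
    fin_cases i <;> simp <;> field_simp

theorem hawaiianCoord_hawaiianPoint (n : ℕ) (m : ℝ) (w : ℂ) :
    hawaiianCoord n ⟨hawaiianPoint n m w, hawaiianPoint_mem n m w⟩ =
      (m ^ 2 / (m ^ 2 + ‖w‖ ^ 2), (m : ℂ) * w / (m ^ 2 + ‖w‖ ^ 2 : ℝ)) := by
  have hn : (n + 1 : ℝ) ≠ 0 := by positivity
  rw [hawaiianCoord_of_mem (x := ⟨_, hawaiianPoint_mem n m w⟩) (hawaiianPoint_mem_sphere n m w)]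
  have h₀ : hawaiianPoint n m w 0 = 2 / ((n + 1) * (m ^ 2 + ‖w‖ ^ 2)) * m ^ 2 := rfl
  have h₁ : hawaiianPoint n m w 1 = 2 / ((n + 1) * (m ^ 2 + ‖w‖ ^ 2)) * (m * w.re) := rfl
  have h₂ : hawaiianPoint n m w 2 = 2 / ((n + 1) * (m ^ 2 + ‖w‖ ^ 2)) * (m * w.im) := rfl
  refine Prod.ext ?_ (Complex.ext ?_ ?_)
  · rw [h₀]
    field_simp
  · rw [Complex.re_ofReal_mul, Complex.div_ofReal_re, Complex.re_ofReal_mul, h₁]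
    field_simp
  · rw [Complex.im_ofReal_mul, Complex.div_ofReal_im, Complex.im_ofReal_mul, h₂]
    field_simp

theorem hawaiianCoord_of_mem_of_ne {m n : ℕ} (hmn : m ≠ n) {x : hawaiianEarring2}
    (hx : (x : EuclideanSpace ℝ (Fin 3)) ∈ Metric.sphere (hawaiianCenter m) (1 / (m + 1))) :
    hawaiianCoord n x = 0 := by
  by_cases hn : (x : EuclideanSpace ℝ (Fin 3)) ∈
    Metric.sphere (hawaiianCenter n) (1 / (n + 1))
  · refine hawaiianCoord_zero ?_
    have h₁ := mem_sphere_hawaiianCenter_iff.mp hx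
    have h₂ := mem_sphere_hawaiianCenter_iff.mp hn
    have h₃ : ((m : ℝ) - n) * ‖(x : EuclideanSpace ℝ (Fin 3))‖ ^ 2 = 0 := by
      linear_combination h₁ - h₂
    simpa [sub_eq_zero, hmn] using h₃
  · exact hawaiianCoord_of_notMem hn

theorem continuous_hawaiianCoord (n : ℕ) : Continuous (hawaiianCoord n) := by
  let A : Set hawaiianEarring2 :=
    {x | (n + 1) * ‖(x : EuclideanSpace ℝ (Fin 3))‖ ^ 2 = 2 * x.1 0}
  let B : Set hawaiianEarring2 :=
    {x | 2 * x.1 0 ≤ n * ‖(x : EuclideanSpace ℝ (Fin 3))‖ ^ 2} ∪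
      {x | (n + 2) * ‖(x : EuclideanSpace ℝ (Fin 3))‖ ^ 2 ≤ 2 * x.1 0}
  have hA : IsClosed A := isClosed_eq (by fun_prop) (by fun_prop)
  have hB : IsClosed B := (isClosed_le (by fun_prop) (by fun_prop)).union
    (isClosed_le (by fun_prop) (by fun_prop))
  have hAB : A ∪ B = univ := by
    refine eq_univ_of_forall fun x => ?_
    obtain ⟨m, hm⟩ := mem_iUnion.mp x.2
    have hm' := mem_sphere_hawaiianCenter_iff.mp hm
    have hsq := sq_nonneg ‖(x : EuclideanSpace ℝ (Fin 3))‖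
    rcases lt_trichotomy m n with h | rfl | h
    · have h' : (m + 1 : ℝ) ≤ n := by exact_mod_cast h
      exact Or.inr (Or.inl (by simp only [mem_ofPred_eq]; nlinarith))
    · exact Or.inl hm'
    · have h' : (n + 1 : ℝ) ≤ m := by exact_mod_cast h
      exact Or.inr (Or.inr (by simp only [mem_ofPred_eq]; nlinarith))
  have hcA : ContinuousOn (hawaiianCoord n) A := by
    refine ContinuousOn.congr (f := fun x : hawaiianEarring2 =>
      ((n + 1) / 2 * x.1 0, ((n + 1) / 2 : ℝ) * (x.1 1 + x.1 2 * Complex.I : ℂ)))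
      (Continuous.continuousOn (by fun_prop)) fun x hx => ?_
    rw [hawaiianCoord_of_mem (mem_sphere_hawaiianCenter_iff.mpr hx), Complex.mk_eq_add_mul_I]
  have hcB : ContinuousOn (hawaiianCoord n) B := by
    refine continuousOn_const (c := 0).congr fun x hx => ?_
    by_cases hn : (x : EuclideanSpace ℝ (Fin 3)) ∈
      Metric.sphere (hawaiianCenter n) (1 / (n + 1))
    · have h := mem_sphere_hawaiianCenter_iff.mp hn
      have hsq : ‖(x : EuclideanSpace ℝ (Fin 3))‖ ^ 2 ≤ 0 := by
        rcases hx with hx | hx <;> simp only [mem_ofPred_eq] at hx <;> linarith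
      refine hawaiianCoord_zero ?_
      simpa using le_antisymm hsq (sq_nonneg _)
    · exact hawaiianCoord_of_notMem hn
  rw [← continuousOn_univ, ← hAB]
  exact hcA.union_of_isClosed hcB hA hB

theorem sq_add_norm_sq_ne_zero {m : ℝ} {w : ℂ} (h : m ≠ 0 ∨ w ≠ 0) : m ^ 2 + ‖w‖ ^ 2 ≠ 0 := by
  rcases h with h | h
  · have := sq_pos_of_ne_zero h
    positivity
  · have := norm_pos_iff.mpr h
    positivity

/-- If every planar function on `T` can be approximated by nonvanishing ones, then every map from
`T` to the earring is contracted to the origin, fixing the preimage of the origin. -/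
theorem homotopicRel_const_of_approx {T : Type*} [TopologicalSpace T]
    (hT : ∀ g : T → ℂ, Continuous g →
      ∃ q : T → ℂ, Continuous q ∧ (∀ t, ‖q t - g t‖ < 2 / 5) ∧ ∀ t, q t ≠ 0)
    {x₀ : hawaiianEarring2} (hx₀ : (x₀ : EuclideanSpace ℝ (Fin 3)) = 0)
    (f : C(T, hawaiianEarring2)) :
    f.HomotopicRel (ContinuousMap.const T x₀) (f ⁻¹' {x₀}) := by
  have hN : ∀ x : hawaiianEarring2, ∃ n : ℕ, (x : EuclideanSpace ℝ (Fin 3)) ∈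
      Metric.sphere (hawaiianCenter n) (1 / (n + 1)) := fun x => mem_iUnion.mp x.2
  choose N hN using hN
  have hNeq : ∀ {n x}, (hawaiianCoord n x).1 ≠ 0 → N x = n := fun {n x} h => by
    by_contra hne
    exact h (by rw [hawaiianCoord_of_mem_of_ne hne (hN x)]; rfl)
  have ha : ∀ n, Continuous fun t => (hawaiianCoord n (f t)).1 := fun n =>
    continuous_fst.comp ((continuous_hawaiianCoord n).comp f.continuous)
  have hb : ∀ n, Continuous fun t => (hawaiianCoord n (f t)).2 := fun n =>
    continuous_snd.comp ((continuous_hawaiianCoord n).comp f.continuous)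
  choose q hqc hqb hq0 using fun n => hT _ (hb n)
  let κ : ℝ → ℝ := fun a => max 0 (min 1 (4 * a - 1))
  have hκ0 : ∀ a, 0 ≤ κ a := fun a => le_max_left _ _
  have hκ1 : ∀ a, κ a ≤ 1 := fun a => max_le zero_le_one (min_le_left _ _)
  have hκc : Continuous κ := by fun_prop
  let M : ℕ → I × T → ℝ := fun n y => (1 - y.1) * (hawaiianCoord n (f y.2)).1
  let W : ℕ → I × T → ℂ := fun n y => (hawaiianCoord n (f y.2)).2 +
    ((y.1 * κ (hawaiianCoord n (f y.2)).1 : ℝ) : ℂ) * (q n y.2 - (hawaiianCoord n (f y.2)).2)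
  have hMc : ∀ n, Continuous (M n) := fun n => by
    have := (ha n).comp (continuous_snd (X := I))
    exact ((continuous_const.sub (continuous_subtype_val.comp continuous_fst)).mul this)
  have hWc : ∀ n, Continuous (W n) := fun n => by
    have h₁ := hκc.comp ((ha n).comp (continuous_snd (X := I)))
    have h₂ := (hb n).comp (continuous_snd (X := I))
    have h₃ := (hqc n).comp (continuous_snd (X := I))
    exact h₂.add ((Complex.continuous_ofReal.comp
      ((continuous_subtype_val.comp continuous_fst).mul h₁)).mul (h₃.sub h₂))
  have hMW : ∀ n y, (hawaiianCoord n (f y.2)).1 ≠ 0 → M n y ^ 2 + ‖W n y‖ ^ 2 ≠ 0 := by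
    rintro n ⟨s, t⟩ h
    refine sq_add_norm_sq_ne_zero ?_
    by_cases hs : s = 1
    · subst hs
      refine Or.inr ?_
      simp only [W, Icc.coe_one, one_mul]
      have hb2 := norm_sq_hawaiianCoord_snd n (f t)
      have ha01 := hawaiianCoord_fst_mem_Icc n (f t)
      have hqt := hqb n t
      set a := (hawaiianCoord n (f t)).1
      set b := (hawaiianCoord n (f t)).2
      have hapos : 0 < a := lt_of_le_of_ne ha01.1 (Ne.symm h)
      rcases le_or_gt (1 / 2) a with h1 | h1
      · have : κ a = 1 := by
          simp only [κ]
          rw [min_eq_left (by linarith), max_eq_right zero_le_one]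
        simpa [this] using hq0 n t
      · intro h0
        have hnorm : ‖b‖ = κ a * ‖q n t - b‖ := by
          rw [← norm_neg, neg_eq_of_add_eq_zero_right h0, norm_mul, Complex.norm_real,
            Real.norm_of_nonneg (hκ0 a)]
        rcases le_or_gt a (1 / 4) with h2 | h2
        · have : κ a = 0 := by
            simp only [κ]
            rw [min_eq_right (by linarith), max_eq_left (by linarith)]
          rw [this, zero_mul] at hnorm
          rw [hnorm] at hb2
          nlinarith
        · have hble : ‖b‖ < 2 / 5 := by
            rw [hnorm]
            nlinarith [hκ1 a, norm_nonneg (q n t - b)]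
          nlinarith [norm_nonneg b]
    · refine Or.inl (mul_ne_zero (sub_ne_zero.mpr fun h1 => hs (Subtype.ext h1.symm)) h)
  let H : I × T → EuclideanSpace ℝ (Fin 3) := fun y =>
    hawaiianPoint (N (f y.2)) (M (N (f y.2)) y) (W (N (f y.2)) y)
  have hHle : ∀ y, ‖H y‖ ≤ 2 * ‖(f y.2 : EuclideanSpace ℝ (Fin 3))‖ := by
    rintro ⟨s, t⟩
    refine (sq_le_sq₀ (norm_nonneg _) (by positivity)).mp ?_
    simp only [H]
    rw [mul_pow, hawaiianCoord_fst_eq (hN (f t)), norm_sq_hawaiianPoint, mul_left_comm]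
    refine mul_le_mul_of_nonneg_left ?_ (by positivity)
    generalize N (f t) = n
    have hb2 := norm_sq_hawaiianCoord_snd n (f t)
    have ha01 := hawaiianCoord_fst_mem_Icc n (f t)
    simp only [M, W]
    set a := (hawaiianCoord n (f t)).1
    set b := (hawaiianCoord n (f t)).2
    rcases le_or_gt (1 / 4) a with h1 | h1
    · refine (div_le_one_of_le₀ ?_ (by positivity)).trans (by linarith)
      exact le_add_of_nonneg_right (by positivity)
    · have : κ a = 0 := by
        simp only [κ]
        rw [min_eq_right (by linarith), max_eq_left (by linarith)]
      rw [this, mul_zero, Complex.ofReal_zero, zero_mul, add_zero, hb2]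
      have h0 := ha01.1
      have hs0 : 0 ≤ 1 - (s : ℝ) := by linarith [s.2.2]
      have hs1 : (1 - (s : ℝ)) ^ 2 ≤ 1 := by nlinarith [s.2.1]
      refine div_le_of_le_mul₀ (by nlinarith) (by linarith) ?_
      nlinarith [mul_nonneg h0 h0, mul_le_mul_of_nonneg_right hs1 (mul_nonneg h0 h0),
        mul_nonneg h0 (sq_nonneg ((1 - (s : ℝ)) * a))]
  have hHc : Continuous H := by
    refine continuous_iff_continuousAt.mpr fun y => ?_
    have hfc : Continuous fun y : I × T => (f y.2 : EuclideanSpace ℝ (Fin 3)) := by fun_prop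
    by_cases h : (f y.2 : EuclideanSpace ℝ (Fin 3)) = 0
    · have hy : H y = 0 := by simpa [h] using hHle y
      rw [ContinuousAt, hy]
      refine squeeze_zero_norm hHle ?_
      have := (hfc.norm.const_mul 2).tendsto y
      rwa [h, norm_zero, mul_zero] at this
    · have hne : (hawaiianCoord (N (f y.2)) (f y.2)).1 ≠ 0 := fun h0 => h <| by
        simpa [h0] using hawaiianCoord_fst_eq (hN (f y.2))
      refine ((hMc (N (f y.2))).continuousAt.hawaiianPoint (n := N (f y.2))
        (hWc (N (f y.2))).continuousAt (hMW _ _ hne)).congr ?_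
      filter_upwards [((ha (N (f y.2))).comp continuous_snd).continuousAt.eventually_ne hne]
        with z hz
      simp only [H, hNeq hz]
  have hHmem : ∀ y, H y ∈ hawaiianEarring2 := fun y => hawaiianPoint_mem _ _ _
  have hH0 : ∀ t, H (0, t) = f t := fun t => by
    simpa [H, M, W] using hawaiianPoint_hawaiianCoord (hN (f t))
  refine ⟨{ toFun := fun y => ⟨H y, hHmem y⟩
            continuous_toFun := hHc.subtype_mk _
            map_zero_left := fun t => Subtype.ext (hH0 t)
            map_one_left := fun t => Subtype.ext ?_
            prop' := fun s t ht => Subtype.ext ?_ }⟩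
  · simp [H, M, hawaiianPoint_zero, hx₀]
  · have ht' : f t = x₀ := ht
    have h0 : H (s, t) = 0 := by simpa [ht', hx₀] using hHle (s, t)
    simp [h0, ht', hx₀]

theorem subsingleton_homotopyGroup_one {x₀ : hawaiianEarring2}
    (hx₀ : (x₀ : EuclideanSpace ℝ (Fin 3)) = 0) :
    Subsingleton (HomotopyGroup (Fin 1) hawaiianEarring2 x₀) := by
  have hT : ∀ g : (Fin 1 → I) → ℂ, Continuous g →
      ∃ q : (Fin 1 → I) → ℂ, Continuous q ∧ (∀ t, ‖q t - g t‖ < 2 / 5) ∧ ∀ t, q t ≠ 0 := by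
    intro g hg
    obtain ⟨q, hq, hqg, hq0⟩ := exists_continuous_ne_zero_near
      (g := fun t => g fun _ => t) (by fun_prop) (show (0 : ℝ) < 2 / 5 by norm_num)
    refine ⟨fun t => q (t 0), by fun_prop, fun t => ?_, fun t => hq0 _⟩
    have ht : (fun _ => t 0) = t := funext fun i => by rw [Subsingleton.elim i 0]
    simpa [ht] using hqg (t 0)
  have key : ∀ p : GenLoop (Fin 1) hawaiianEarring2 x₀, GenLoop.Homotopic p GenLoop.const :=
    fun p => by
      obtain ⟨F⟩ := homotopicRel_const_of_approx hT hx₀ p.1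
      exact ⟨{ F with prop' := fun s y hy => F.prop' s y (p.2 y hy) }⟩
  refine ⟨fun a b => ?_⟩
  induction a using Quotient.inductionOn with | _ p
  induction b using Quotient.inductionOn with | _ p'
  exact Quotient.sound ((key p).trans (key p').symm)

/-- The matrix with rows `(1 - a, b)` and `(conj b, a)` as an operator on `ℂ²`. -/
noncomputable def lineProjection (c : ℝ × ℂ) : ℂ × ℂ →L[ℂ] ℂ × ℂ :=
  (((1 - c.1 : ℝ) : ℂ) • ContinuousLinearMap.fst ℂ ℂ ℂ +
    c.2 • ContinuousLinearMap.snd ℂ ℂ ℂ).prod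
  ((starRingEnd ℂ c.2) • ContinuousLinearMap.fst ℂ ℂ ℂ +
    (c.1 : ℂ) • ContinuousLinearMap.snd ℂ ℂ ℂ)

theorem lineProjection_apply (c : ℝ × ℂ) (v : ℂ × ℂ) : lineProjection c v =
    ((1 - c.1) * v.1 + c.2 * v.2, starRingEnd ℂ c.2 * v.1 + c.1 * v.2) := by
  simp [lineProjection]

theorem continuous_lineProjection : Continuous lineProjection := by
  have h₁ : Continuous fun c : ℝ × ℂ => ((1 - c.1 : ℝ) : ℂ) • ContinuousLinearMap.fst ℂ ℂ ℂ +
      c.2 • ContinuousLinearMap.snd ℂ ℂ ℂ := by fun_prop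
  have h₂ : Continuous fun c : ℝ × ℂ =>
      (starRingEnd ℂ c.2) • ContinuousLinearMap.fst ℂ ℂ ℂ +
        (c.1 : ℂ) • ContinuousLinearMap.snd ℂ ℂ ℂ := by
    have := Complex.continuous_conj
    fun_prop
  exact (ContinuousLinearMap.prodₗᵢ ℂ).continuous.comp (h₁.prodMk h₂)

theorem lineProjection_idem {c : ℝ × ℂ} (hc : ‖c.2‖ ^ 2 = c.1 - c.1 ^ 2) (v : ℂ × ℂ) :
    lineProjection c (lineProjection c v) = lineProjection c v := by
  have h : c.2 * starRingEnd ℂ c.2 = c.1 - c.1 ^ 2 := by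
    rw [Complex.mul_conj, Complex.normSq_eq_norm_sq, hc]
    push_cast
    ring
  simp only [lineProjection_apply]
  ext
  · linear_combination v.1 * h
  · linear_combination v.2 * h

/-- The point of the plane, in `[-1, 1]²`, corresponding to a point of the unit square. -/
noncomputable def squarePoint (y : Fin 2 → I) : ℂ := ⟨2 * y 0 - 1, 2 * y 1 - 1⟩

/-- A function on the unit square vanishing exactly on the boundary. -/
noncomputable def squareBump (y : Fin 2 → I) : ℝ := y 0 * (1 - y 0) * (y 1 * (1 - y 1))

theorem continuous_squarePoint : Continuous squarePoint := by
  have : squarePoint = fun y => ((2 * y 0 - 1 : ℝ) : ℂ) + ((2 * y 1 - 1 : ℝ) : ℂ) * Complex.I :=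
    funext fun y => Complex.mk_eq_add_mul_I _ _
  rw [this]
  fun_prop

theorem continuous_squareBump : Continuous squareBump := by
  unfold squareBump
  fun_prop

theorem squareBump_of_mem_boundary {y : Fin 2 → I} (hy : y ∈ Cube.boundary (Fin 2)) :
    squareBump y = 0 := by
  obtain ⟨i, hi⟩ := hy
  fin_cases i <;> rcases hi with h | h <;> simp_all [squareBump]

theorem squareBump_sq_add_ne_zero (y : Fin 2 → I) :
    squareBump y ^ 2 + ‖squarePoint y‖ ^ 2 ≠ 0 := by
  refine sq_add_norm_sq_ne_zero (or_iff_not_imp_right.mpr fun h => ?_)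
  rw [not_not, Complex.ext_iff] at h
  simp only [squarePoint, Complex.zero_re, Complex.zero_im] at h
  have h0 : (y 0 : ℝ) = 1 / 2 := by linarith
  have h1 : (y 1 : ℝ) = 1 / 2 := by linarith
  norm_num [squareBump, h0, h1]

/-- The 2-loop parametrizing the `n`-th sphere. -/
noncomputable def sphereLoop (n : ℕ) {x₀ : hawaiianEarring2}
    (hx₀ : (x₀ : EuclideanSpace ℝ (Fin 3)) = 0) : GenLoop (Fin 2) hawaiianEarring2 x₀ :=
  ⟨⟨fun y => ⟨hawaiianPoint n (squareBump y) (squarePoint y), hawaiianPoint_mem _ _ _⟩,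
    Continuous.subtype_mk (continuous_iff_continuousAt.mpr fun y =>
      continuous_squareBump.continuousAt.hawaiianPoint continuous_squarePoint.continuousAt
        (squareBump_sq_add_ne_zero y)) _⟩,
    fun y hy => Subtype.ext (by
      simp [squareBump_of_mem_boundary hy, hawaiianPoint_zero, hx₀])⟩

theorem tendsto_sphereLoop {x₀ : hawaiianEarring2}
    (hx₀ : (x₀ : EuclideanSpace ℝ (Fin 3)) = 0) :
    Tendsto (fun n => sphereLoop n hx₀) atTop (𝓝 GenLoop.const) := by
  rw [tendsto_subtype_rng, ContinuousMap.tendsto_iff_tendstoUniformly,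
    Metric.tendstoUniformly_iff]
  intro ε hε
  have hlim : Tendsto (fun n : ℕ => 2 * (1 / ((n : ℝ) + 1))) atTop (𝓝 (2 * 0)) :=
    tendsto_one_div_add_atTop_nhds_zero_nat.const_mul 2
  rw [mul_zero] at hlim
  filter_upwards [hlim.eventually_lt_const hε] with n hn y
  have : dist x₀ ⟨hawaiianPoint n (squareBump y) (squarePoint y), hawaiianPoint_mem _ _ _⟩ < ε := by
    rw [Subtype.dist_eq, hx₀, dist_zero_left]
    refine (norm_hawaiianPoint_le _ _ _).trans_lt (lt_of_eq_of_lt ?_ hn)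
    ring
  exact this

theorem not_homotopic_sphereLoop (n : ℕ) {x₀ : hawaiianEarring2}
    (hx₀ : (x₀ : EuclideanSpace ℝ (Fin 3)) = 0) :
    ¬ GenLoop.Homotopic GenLoop.const (sphereLoop n hx₀) := by
  rintro ⟨F⟩
  let P : I × (Fin 2 → I) → ℂ × ℂ →L[ℂ] ℂ × ℂ := fun y => lineProjection (hawaiianCoord n (F y))
  have hP : Continuous P :=
    continuous_lineProjection.comp ((continuous_hawaiianCoord n).comp F.continuous)
  have hbase : lineProjection (hawaiianCoord n x₀) (1, 0) = (1, 0) := by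
    simp [hawaiianCoord_zero hx₀, lineProjection_apply]
  obtain ⟨G, hGc, hG0, hGP, hGb⟩ := exists_continuous_fixed_of_idempotent hP
    (fun y v => lineProjection_idem (norm_sq_hawaiianCoord_snd n (F y)) v)
    (v₀ := (1, 0)) (by simp) (fun y => by
      have : F (0, y) = x₀ := F.apply_zero y
      simp only [P, this, hbase])
  have hGbd : ∀ y ∈ Cube.boundary (Fin 2), G y = (1, 0) := fun y hy => hGb y fun t => by
    have : F (t, y) = x₀ := F.eq_fst t hy
    simp only [P, this, hbase]
  let D : (Fin 2 → I) → ℝ := fun y => squareBump y ^ 2 + ‖squarePoint y‖ ^ 2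
  let lam : (Fin 2 → I) → ℂ := fun y =>
    (starRingEnd ℂ (squarePoint y) * (G y).1 + squareBump y * (G y).2) / (D y : ℂ)
  have hDne : ∀ y, (D y : ℂ) ≠ 0 := fun y => by exact_mod_cast squareBump_sq_add_ne_zero y
  have hw := continuous_squarePoint
  have hm := continuous_squareBump
  have hlamc : Continuous lam := by
    have := Complex.continuous_conj
    exact Continuous.div (by fun_prop) (by fun_prop) hDne
  have hG : ∀ y, G y = (lam y * squarePoint y, lam y * squareBump y) := fun y => by
    have h := hGP y
    have hF : hawaiianCoord n (F (1, y)) =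
        (squareBump y ^ 2 / D y, (squareBump y : ℂ) * squarePoint y / (D y : ℝ)) := by
      rw [show F (1, y) = _ from F.apply_one y]
      exact hawaiianCoord_hawaiianPoint _ _ _
    have hD := hDne y
    have hDw : (D y : ℂ) = squareBump y ^ 2 + squarePoint y * starRingEnd ℂ (squarePoint y) := by
      rw [Complex.mul_conj, Complex.normSq_eq_norm_sq]
      push_cast [D]
      ring
    simp only [P, hF, lineProjection_apply] at h
    rw [← h]
    ext
    · simp only [lam]
      push_cast
      field_simp
      rw [hDw]
      ring
    · simp only [lam, map_div₀, map_mul, Complex.conj_ofReal]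
      push_cast
      field_simp
  have hlam0 : ∀ y, lam y ≠ 0 := fun y h => hG0 y (by rw [hG y, h]; simp)
  let toSquare : ℂ → Fin 2 → I := fun z =>
    ![projIcc 0 1 zero_le_one ((z.re + 1) / 2), projIcc 0 1 zero_le_one ((z.im + 1) / 2)]
  have hsqc : Continuous toSquare := by
    refine continuous_pi fun i => ?_
    fin_cases i
    · exact (continuous_projIcc (h := zero_le_one)).comp (by fun_prop)
    · exact (continuous_projIcc (h := zero_le_one)).comp (by fun_prop)
  refine not_continuous_ne_zero_of_mul_eq_const (hlamc.comp hsqc) (fun z => hlam0 _) (c := 1)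
    fun z hz => ?_
  have hre : |z.re| ≤ 1 := hz ▸ le_max_left _ _
  have him : |z.im| ≤ 1 := hz ▸ le_max_right _ _
  rw [abs_le] at hre him
  have h0 : (toSquare z 0 : ℝ) = (z.re + 1) / 2 := by
    simp only [toSquare, Matrix.cons_val_zero]
    rw [projIcc_of_mem _ (⟨by linarith, by linarith⟩ : (z.re + 1) / 2 ∈ Icc (0 : ℝ) 1)]
  have h1 : (toSquare z 1 : ℝ) = (z.im + 1) / 2 := by
    simp only [toSquare, Matrix.cons_val_one, Matrix.cons_val_zero]
    rw [projIcc_of_mem _ (⟨by linarith, by linarith⟩ : (z.im + 1) / 2 ∈ Icc (0 : ℝ) 1)]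
  have hpt : squarePoint (toSquare z) = z := by
    apply Complex.ext
    · simp only [squarePoint, h0]; ring
    · simp only [squarePoint, h1]; ring
  have hbd : toSquare z ∈ Cube.boundary (Fin 2) := by
    rcases max_choice |z.re| |z.im| with h | h
    · refine ⟨0, ?_⟩
      rw [h] at hz
      rcases eq_or_eq_neg_of_abs_eq hz with h' | h'
      · exact Or.inr (Subtype.ext (by rw [h0, h']; norm_num))
      · exact Or.inl (Subtype.ext (by rw [h0, h']; norm_num))
    · refine ⟨1, ?_⟩
      rw [h] at hz
      rcases eq_or_eq_neg_of_abs_eq hz with h' | h'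
      · exact Or.inr (Subtype.ext (by rw [h1, h']; norm_num))
      · exact Or.inl (Subtype.ext (by rw [h1, h']; norm_num))
  have := congrArg Prod.fst ((hG (toSquare z)).symm.trans (hGbd _ hbd))
  simpa [hpt] using this

/-- For the 2-dimensional Hawaiian earring X based at the origin, π₁(X, 0) is trivial,
but π₂^top(X, 0) is not discrete: there is a sequence of nontrivial classes (the
classes of the spheres) converging to the identity. -/
theorem hawaiianEarring2_pi1_trivial_pi2_not_discrete
    (x₀ : hawaiianEarring2) (hx₀ : (x₀ : EuclideanSpace ℝ (Fin 3)) = 0) :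
    Subsingleton (HomotopyGroup (Fin 1) hawaiianEarring2 x₀) ∧
      ¬ DiscreteTopology (HomotopyGroup (Fin 2) hawaiianEarring2 x₀) ∧
      ∃ f : ℕ → HomotopyGroup (Fin 2) hawaiianEarring2 x₀,
        (∀ n, f n ≠ 1) ∧ Tendsto f atTop (𝓝 1) := by
  have hex : ∃ f : ℕ → HomotopyGroup (Fin 2) hawaiianEarring2 x₀,
      (∀ n, f n ≠ 1) ∧ Tendsto f atTop (𝓝 1) := by
    refine ⟨fun n => (⟦sphereLoop n hx₀⟧ : HomotopyGroup (Fin 2) hawaiianEarring2 x₀),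
      fun n h => ?_, ?_⟩
    · rw [HomotopyGroup.one_def] at h
      exact not_homotopic_sphereLoop n hx₀ (Quotient.exact h).symm
    · rw [HomotopyGroup.one_def]
      exact (continuous_quotient_mk'.tendsto _).comp (tendsto_sphereLoop hx₀)
  refine ⟨subsingleton_homotopyGroup_one hx₀, fun hdisc => ?_, hex⟩
  obtain ⟨f, hne, hf⟩ := hex
  rw [nhds_discrete, tendsto_pure] at hf
  obtain ⟨n, hn⟩ := hf.exists
  exact hne n hn
end

section
/- Discreteness of π_n^top is a homotopy invariant that can distinguish spaces with the same topological fundamental group: there exists a metric space X (the 2-dimensional Hawaiian earring) with π_1^top(X) trivial (in particular discrete) but π_2^top(X) not discrete; hence X is not homotopy equivalent to any space whose π_2^top is discrete. -/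
open scoped unitInterval Topology
open Set Filter

/-- The property of a pointed metric space of having trivial (hence discrete)
π₁^top but non-discrete π₂^top, and consequently not being homotopy equivalent to
any space with discrete π₂^top. -/
def HasTrivialPi1ButNonDiscretePi2 (X : Type*) [MetricSpace X] (x : X) : Prop :=
  Subsingleton (HomotopyGroup (Fin 1) X x) ∧
    DiscreteTopology (HomotopyGroup (Fin 1) X x) ∧
    ¬ DiscreteTopology (HomotopyGroup (Fin 2) X x) ∧
    ∀ (Y : Type*) [TopologicalSpace Y] (h : ContinuousMap.HomotopyEquiv X Y),
      ¬ DiscreteTopology (HomotopyGroup (Fin 2) Y (h.toFun x))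

noncomputable section

namespace LineSpace

instance : ContractibleSpace I := (convex_Icc (0 : ℝ) 1).contractibleSpace ⟨0, by simp⟩

instance (ι : Type*) : ContractibleSpace (ι → I) := by
  rw [contractible_iff_id_nullhomotopic]
  exact ⟨fun _ => 0, ⟨
    { toFun := fun q i => unitInterval.symm q.1 * q.2 i
      continuous_toFun := by fun_prop
      map_zero_left := fun p => by ext; simp
      map_one_left := fun p => by ext; simp }⟩⟩

variable {H : Type*} [NormedAddCommGroup H] [InnerProductSpace ℂ H]

/-- The orthogonal projection onto the line spanned by `v` (and `0` if `v = 0`). -/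
def lineProj (v : H) : H →L[ℂ] H :=
  ((‖v‖ : ℂ) ^ 2)⁻¹ • InnerProductSpace.rankOne ℂ v v

theorem lineProj_apply (v x : H) : lineProj v x = (((‖v‖ : ℂ) ^ 2)⁻¹ * inner ℂ v x) • v := by
  simp [lineProj, smul_smul]

theorem lineProj_self {v : H} (hv : v ≠ 0) : lineProj v v = v := by
  have : (‖v‖ : ℂ) ≠ 0 := by simpa using hv
  rw [lineProj_apply, inner_self_eq_norm_sq_to_K]
  simp [this]

theorem lineProj_smul {c : ℂ} (hc : c ≠ 0) (v : H) : lineProj (c • v) = lineProj v := by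
  ext x
  have h : (starRingEnd ℂ) c * c = (‖c‖ : ℂ) ^ 2 := by
    rw [mul_comm, Complex.mul_conj']
  have hc' : (‖c‖ : ℂ) ≠ 0 := by simpa using hc
  simp only [lineProj_apply, norm_smul, inner_smul_left, smul_smul]
  congr 1
  push_cast
  rw [mul_pow, mul_inv]
  calc _ = ((‖c‖ : ℂ) ^ 2)⁻¹ * ((starRingEnd ℂ) c * c) * (((‖v‖ : ℂ) ^ 2)⁻¹ * inner ℂ v x) := by
        ring
    _ = _ := by rw [h, inv_mul_cancel₀ (pow_ne_zero 2 hc'), one_mul]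

variable (H) in
/-- The space of lines in `H`, topologized as the space of rank one orthogonal projections. -/
def Line : Type _ := {P : H →L[ℂ] H // ∃ v : H, v ≠ 0 ∧ P = lineProj v}

instance : MetricSpace (Line H) := inferInstanceAs (MetricSpace (Subtype _))

/-- The tautological map from nonzero vectors to lines. -/
def mkLine (v : {v : H // v ≠ 0}) : Line H := ⟨lineProj v.1, v.1, v.2, rfl⟩

theorem continuous_mkLine : Continuous (mkLine (H := H)) := by
  refine Continuous.subtype_mk ?_ _
  unfold lineProj
  have hnorm : Continuous fun v : {v : H // v ≠ 0} => ((‖v.1‖ : ℂ) ^ 2) := by fun_prop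
  refine (hnorm.inv₀ fun v => ?_).smul ?_
  · simpa using v.2
  · exact (ContinuousLinearMap.smulRightL ℂ H H).continuous₂.comp
      (((innerSL ℂ).continuous.comp continuous_subtype_val).prodMk continuous_subtype_val)

/-- A vector lies on a line. -/
def OnLine (x : H) (l : Line H) : Prop := l.1 x = x

theorem onLine_mkLine (v : {v : H // v ≠ 0}) : OnLine v.1 (mkLine v) := lineProj_self v.2

theorem onLine_apply (l : Line H) (x : H) : OnLine (l.1 x) l := by
  obtain ⟨P, v, hv, rfl⟩ := l
  simp only [OnLine]
  rw [lineProj_apply v x, map_smul, lineProj_self hv]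

theorem OnLine.eq_mkLine {x : H} {l : Line H} (h : OnLine x l) (hx : x ≠ 0) :
    l = mkLine ⟨x, hx⟩ := by
  obtain ⟨P, v, hv, rfl⟩ := l
  refine Subtype.ext ?_
  have h' : lineProj v x = x := h
  rw [lineProj_apply] at h'
  change lineProj v = lineProj x
  generalize ((‖v‖ : ℂ) ^ 2)⁻¹ * inner ℂ v x = c at h'
  subst h'
  rw [lineProj_smul (by rintro rfl; simp at hx)]

theorem OnLine.exists_smul {x y : H} {l : Line H} (hx : OnLine x l) (hx0 : x ≠ 0)
    (hy : OnLine y l) : ∃ c : ℂ, y = c • x := by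
  rw [hx.eq_mkLine hx0] at hy
  exact ⟨_, hy.symm.trans (lineProj_apply x y)⟩

theorem OnLine.inner_ne_zero {x y : H} {l : Line H} (hx : OnLine x l) (hx0 : x ≠ 0)
    (hy : OnLine y l) (hy0 : y ≠ 0) : inner ℂ x y ≠ 0 := by
  obtain ⟨c, rfl⟩ := hx.exists_smul hx0 hy
  rw [inner_smul_right]
  exact mul_ne_zero (by rintro rfl; simp at hy0) (inner_self_ne_zero.2 hx0)

theorem OnLine.apply_ne_zero {x : H} {l m : Line H} (hx : OnLine x l) (hx0 : x ≠ 0)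
    (hlm : dist l m < 1) : m.1 x ≠ 0 := by
  intro h
  have h1 : ‖(l.1 - m.1) x‖ ≤ ‖l.1 - m.1‖ * ‖x‖ := (l.1 - m.1).le_opNorm x
  have h2 : dist l m = ‖l.1 - m.1‖ := dist_eq_norm l.1 m.1
  have h3 : (l.1 - m.1) x = x := by
    rw [sub_apply, h, sub_zero]; exact hx
  rw [h3, ← h2] at h1
  nlinarith [norm_pos_iff.2 hx0]

/-- A continuous family of lines over a compact contractible base has a nowhere vanishing
continuous section. -/
theorem exists_section {A : Type*} [MetricSpace A] [CompactSpace A] [ContractibleSpace A]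
    (F : C(A, Line H)) : ∃ v : C(A, H), ∀ a, v a ≠ 0 ∧ OnLine (v a) (F a) := by
  obtain ⟨a₀, ⟨K⟩⟩ := id_nullhomotopic A
  let G : C(I × A, Line H) := F.comp K.symm.toContinuousMap
  have hG0 : ∀ a, G (0, a) = F a₀ := fun a => by simp [G]
  have hG1 : ∀ a, G (1, a) = F a := fun a => by simp [G]
  obtain ⟨δ, hδ, hG⟩ := Metric.uniformContinuous_iff.1
    (CompactSpace.uniformContinuous_of_continuous G.continuous) 1 one_pos
  obtain ⟨N, hN⟩ := exists_nat_one_div_lt hδ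
  have hval : Continuous fun q : I × A => (G q).1 := continuous_subtype_val.comp G.continuous
  let s : ℕ → I := fun k => Set.projIcc 0 1 zero_le_one ((k : ℝ) / (N + 1))
  have key : ∀ k : ℕ, k ≤ N + 1 →
      ∃ v : C(A, H), ∀ a, v a ≠ 0 ∧ OnLine (v a) (G (s k, a)) := by
    intro k
    induction k with
    | zero =>
      intro _
      obtain ⟨v, hv, hv'⟩ := (F a₀).2
      refine ⟨ContinuousMap.const A v, fun a => ⟨hv, ?_⟩⟩
      have : s 0 = 0 := by simp [s]
      rw [this, hG0]
      change (F a₀).1 v = v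
      rw [hv', lineProj_self hv]
    | succ k ih =>
      intro hk
      obtain ⟨v, hv⟩ := ih (by omega)
      refine ⟨⟨fun a => (G (s (k + 1), a)).1 (v a), ?_⟩, fun a => ⟨?_, onLine_apply _ _⟩⟩
      · exact (hval.comp (by fun_prop)).clm_apply v.continuous
      · refine (hv a).2.apply_ne_zero (hv a).1 (hG ?_)
        rw [Prod.dist_eq, dist_self, max_eq_left dist_nonneg]
        refine lt_of_le_of_lt ?_ hN
        rw [Subtype.dist_eq, Real.dist_eq]
        refine (abs_projIcc_sub_projIcc zero_le_one).trans ?_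
        rw [← sub_div]
        push_cast
        rw [sub_add_cancel_left, abs_div, abs_neg, abs_one, abs_of_pos (by positivity)]
  obtain ⟨v, hv⟩ := key (N + 1) le_rfl
  refine ⟨v, fun a => ?_⟩
  have : s (N + 1) = 1 := by
    simp only [s]
    push_cast
    rw [div_self (by positivity)]
    exact Set.projIcc_right _
  simpa [this, hG1] using hv a

/-- If the nonzero vectors form a contractible space, then every loop of lines is null homotopic. -/
theorem path_quotient_subsingleton [ContractibleSpace {v : H // v ≠ 0}] (e : {v : H // v ≠ 0}) :
    Subsingleton (Path.Homotopic.Quotient (mkLine e) (mkLine e)) := by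
  have key : ∀ γ : Path (mkLine e) (mkLine e), γ.Homotopic (Path.refl _) := by
    intro γ
    obtain ⟨v, hv⟩ := exists_section γ.toContinuousMap
    obtain ⟨a, ha⟩ := (hv 0).2.exists_smul (hv 0).1 (y := e.1) (by simpa using onLine_mkLine e)
    obtain ⟨b, hb⟩ := (hv 1).2.exists_smul (hv 1).1 (y := e.1) (by simpa using onLine_mkLine e)
    have ha0 : a ≠ 0 := by rintro rfl; exact e.2 (by simpa using ha)
    have hb0 : b ≠ 0 := by rintro rfl; exact e.2 (by simpa using hb)
    let c : I → ℂ := fun t =>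
      Complex.exp ((1 - (t : ℝ) : ℂ) * Complex.log a + (t : ℝ) * Complex.log b)
    have hc : Continuous c := by fun_prop
    have hne : ∀ t, c t • v t ≠ 0 := fun t => smul_ne_zero (Complex.exp_ne_zero _) (hv t).1
    let Γ : Path e e :=
      { toFun := fun t => ⟨c t • v t, hne t⟩
        continuous_toFun := Continuous.subtype_mk (by fun_prop) _
        source' := Subtype.ext (by simp [c, Complex.exp_log ha0, ha])
        target' := Subtype.ext (by simp [c, Complex.exp_log hb0, hb]) }
    have hΓ : Γ.map continuous_mkLine = γ := by
      ext t
      refine (((hv t).2.eq_mkLine (hv t).1).trans ?_).symm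
      exact Subtype.ext (lineProj_smul (Complex.exp_ne_zero _) _).symm
    have := (SimplyConnectedSpace.paths_homotopic Γ (Path.refl e)).map
      ⟨mkLine, continuous_mkLine⟩
    rw [← hΓ]
    exact this
  refine ⟨fun p q => ?_⟩
  induction p using Quotient.inductionOn with | _ p
  induction q using Quotient.inductionOn with | _ q
  exact Quotient.sound ((key p).trans (key q).symm)

/-- The Hilbert space of square summable complex sequences. -/
abbrev Hilb : Type := lp (fun _ : ℕ => ℂ) 2

/-- The shift `(x₀, x₁, …) ↦ (0, x₀, x₁, …)`, as a sequence-level operation. -/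
def shiftSeq (x : ℕ → ℂ) : ℕ → ℂ
  | 0 => 0
  | k + 1 => x k

theorem hasSum_shiftSeq (x : Hilb) :
    HasSum (fun k => ‖shiftSeq x k‖ ^ (2 : ENNReal).toReal) (‖x‖ ^ (2 : ENNReal).toReal) := by
  rw [← hasSum_nat_add_iff' 1]
  simpa [shiftSeq] using lp.hasSum_norm (p := 2) (by simp) x

/-- The unilateral shift on `Hilb`. -/
def shift : Hilb →ₗᵢ[ℂ] Hilb where
  toFun x := ⟨shiftSeq x, memℓp_gen (hasSum_shiftSeq x).summable⟩
  map_add' x y := by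
    refine lp.ext (funext fun k => ?_)
    rcases k with _ | k
    · exact (add_zero (0 : ℂ)).symm
    · rfl
  map_smul' c x := by
    ext k
    cases k <;> simp [shiftSeq]
  norm_map' x := by
    have h := lp.hasSum_norm (p := 2) (by simp)
      (⟨shiftSeq x, memℓp_gen (hasSum_shiftSeq x).summable⟩ : Hilb)
    have := h.unique (hasSum_shiftSeq x)
    simpa using this

theorem shift_apply_zero (x : Hilb) : shift x 0 = 0 := rfl

theorem shift_apply_succ (x : Hilb) (k : ℕ) : shift x (k + 1) = x k := rfl

/-- The standard basis vectors of `Hilb`. -/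
def basisVec (i : ℕ) : Hilb := lp.single 2 i 1

theorem basisVec_ne_zero (i : ℕ) : basisVec i ≠ 0 := fun h => by
  simpa [basisVec] using congrArg (fun x : Hilb => x i) h

theorem lerp_shift_ne_zero {x : Hilb} (hx : x ≠ 0) (t : ℝ) :
    ((1 - t : ℝ) : ℂ) • x + (t : ℂ) • shift x ≠ 0 := by
  intro h
  rcases eq_or_ne t 1 with rfl | ht
  · rw [sub_self, Complex.ofReal_zero, zero_smul, zero_add, Complex.ofReal_one, one_smul] at h
    exact hx (shift.injective (by rw [h, map_zero]))
  · have ht' : (1 - t : ℂ) ≠ 0 := by exact_mod_cast sub_ne_zero.2 ht.symm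
    have hcoord : ∀ k, ((1 - t : ℝ) : ℂ) * x k + (t : ℂ) * shift x k = 0 :=
      fun k => congrArg (fun y : Hilb => y k) h
    refine hx (lp.ext (funext fun k => ?_))
    change x k = 0
    induction k with
    | zero => simpa [shift_apply_zero, ht'] using hcoord 0
    | succ k ih => simpa [shift_apply_succ, ih, ht'] using hcoord (k + 1)

theorem lerp_basisVec_ne_zero {x : Hilb} (hx : x ≠ 0) (t : ℝ) :
    ((1 - t : ℝ) : ℂ) • shift x + (t : ℂ) • basisVec 0 ≠ 0 := by
  intro h
  have h0 : ((1 - t : ℝ) : ℂ) * shift x 0 + (t : ℂ) * basisVec 0 0 = 0 :=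
    congrArg (fun y : Hilb => y 0) h
  have ht : t = 0 := by simpa [shift_apply_zero, basisVec] using h0
  subst ht
  rw [sub_zero, Complex.ofReal_zero, zero_smul, add_zero, Complex.ofReal_one, one_smul] at h
  exact hx (shift.injective (by rw [h, map_zero]))

instance : ContractibleSpace {x : Hilb // x ≠ 0} := by
  rw [contractible_iff_id_nullhomotopic]
  let S : C({x : Hilb // x ≠ 0}, {x : Hilb // x ≠ 0}) :=
    ⟨fun x => ⟨shift x.1, fun h => x.2 (shift.injective (by rw [h, map_zero]))⟩,
      Continuous.subtype_mk (shift.continuous.comp continuous_subtype_val) _⟩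
  have hS : Continuous fun q : I × {x : Hilb // x ≠ 0} => shift q.2.1 :=
    shift.continuous.comp (continuous_subtype_val.comp continuous_snd)
  have h₁ : (ContinuousMap.id _).Homotopic S := ⟨
    { toFun := fun q => ⟨_, lerp_shift_ne_zero q.2.2 q.1⟩
      continuous_toFun := Continuous.subtype_mk (by fun_prop) _
      map_zero_left := fun x => Subtype.ext (by simp)
      map_one_left := fun x => Subtype.ext (by simp [S]) }⟩
  have h₂ : S.Homotopic (ContinuousMap.const _ ⟨basisVec 0, basisVec_ne_zero 0⟩) := ⟨
    { toFun := fun q => ⟨_, lerp_basisVec_ne_zero q.2.2 q.1⟩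
      continuous_toFun := Continuous.subtype_mk (by fun_prop) _
      map_zero_left := fun x => Subtype.ext (by simp [S])
      map_one_left := fun x => Subtype.ext (by simp) }⟩
  exact ⟨_, h₁.trans h₂⟩

/-- A nowhere vanishing function on the plane cannot point in the direction of `z` at every point
`z` of a circle around the origin. -/
theorem false_of_winding (h : C(ℂ, ℂ)) (hne : ∀ z, h z ≠ 0) {R : ℝ} (hR : 0 < R)
    (hcirc : ∀ z, ‖z‖ = R → ∃ r : ℝ, 0 < r ∧ h z = r * z) : False := by
  obtain ⟨L, ⟨-, hL⟩, -⟩ := Complex.isCoveringMapOn_exp.existsUnique_continuousMap_lifts h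
    (a₀ := 0) (Complex.exp_log (hne 0)) (fun z => hne z)
  have hL' : ∀ z, Complex.exp (L z) = h z := fun z => congrFun hL z
  let φ : ℝ → ℝ := fun θ => ((L (R * Complex.exp (θ * Complex.I))).im - θ) / (2 * Real.pi)
  have hφ : Continuous φ := by fun_prop
  have hint : ∀ θ, ∃ n : ℤ, φ θ = n := by
    intro θ
    have hnorm : ‖(R * Complex.exp (θ * Complex.I) : ℂ)‖ = R := by
      rw [norm_mul, Complex.norm_exp_ofReal_mul_I, mul_one, Complex.norm_real,
        Real.norm_of_nonneg hR.le]
    obtain ⟨r, hr, hz⟩ := hcirc _ hnorm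
    have hrR : 0 < r * R := mul_pos hr hR
    have h1 : Complex.exp (L (R * Complex.exp (θ * Complex.I)))
        = Complex.exp (Real.log (r * R) + θ * Complex.I) := by
      rw [hL', hz, Complex.exp_add, ← Complex.ofReal_exp, Real.exp_log hrR]
      push_cast
      ring
    obtain ⟨n, hn⟩ := Complex.exp_eq_exp_iff_exists_int.1 h1
    refine ⟨n, ?_⟩
    have him := congrArg Complex.im hn
    simp at him
    simp only [φ]
    rw [him]
    field_simp
    ring
  have hconst : φ 0 = φ (2 * Real.pi) := by
    choose m hm using hint
    have hmc : Continuous m := by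
      rw [Int.isClosedEmbedding_coe_real.isInducing.continuous_iff]
      exact hφ.congr hm
    have := PreconnectedSpace.constant inferInstance hmc (x := 0) (y := 2 * Real.pi)
    rw [hm, hm, this]
  have hper : Complex.exp (((2 * Real.pi : ℝ) : ℂ) * Complex.I)
      = Complex.exp (((0 : ℝ) : ℂ) * Complex.I) := by
    simp [Complex.exp_two_pi_mul_I]
  have hpi := Real.pi_pos
  simp only [φ] at hconst
  rw [hper, div_left_inj' (by positivity)] at hconst
  linarith

/-- The sup norm on `ℂ = ℝ²`. -/
def supNorm (z : ℂ) : ℝ := max |z.re| |z.im|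

theorem continuous_supNorm : Continuous supNorm := by
  unfold supNorm; fun_prop

/-- The identification of the unit square with the square `[-1, 1]²` in the plane. -/
def squareCoord (p : Fin 2 → I) : ℂ := ⟨2 * (p 0 : ℝ) - 1, 2 * (p 1 : ℝ) - 1⟩

theorem continuous_squareCoord : Continuous squareCoord := by
  have : squareCoord = fun p : Fin 2 → I =>
      ((2 * (p 0 : ℝ) - 1 : ℝ) : ℂ) + ((2 * (p 1 : ℝ) - 1 : ℝ) : ℂ) * Complex.I := by
    funext p
    apply Complex.ext <;> simp [squareCoord]
  rw [this]
  fun_prop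

theorem abs_two_mul_sub_one_le (t : I) : |2 * (t : ℝ) - 1| ≤ 1 := by
  rw [abs_le]
  constructor <;> linarith [t.2.1, t.2.2]

theorem supNorm_squareCoord_eq_one {p : Fin 2 → I} (hp : p ∈ Cube.boundary (Fin 2)) :
    supNorm (squareCoord p) = 1 := by
  have h0 := abs_two_mul_sub_one_le (p 0)
  have h1 := abs_two_mul_sub_one_le (p 1)
  obtain ⟨i, hi⟩ := hp
  have hi' : |2 * (p i : ℝ) - 1| = 1 := by
    rcases hi with hi | hi <;> rw [hi] <;> norm_num
  fin_cases i
  · exact (max_eq_left (h1.trans hi'.ge)).trans hi'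
  · exact (max_eq_right (h0.trans hi'.ge)).trans hi'

theorem squareCoord_ne_zero {p : Fin 2 → I} (hp : p ∈ Cube.boundary (Fin 2)) :
    squareCoord p ≠ 0 := fun h => by
  simpa [h, supNorm] using supNorm_squareCoord_eq_one hp

/-- A section of the Hopf family of lines over the square. -/
def hopfVec (p : Fin 2 → I) : Hilb :=
  squareCoord p • basisVec 0 + ((1 - supNorm (squareCoord p) : ℝ) : ℂ) • basisVec 1

theorem continuous_hopfVec : Continuous hopfVec := by
  have h1 := continuous_squareCoord
  have h2 := continuous_supNorm.comp h1
  exact (h1.smul continuous_const).add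
    ((Complex.continuous_ofReal.comp (continuous_const.sub h2)).smul continuous_const)

theorem hopfVec_ne_zero (p : Fin 2 → I) : hopfVec p ≠ 0 := by
  intro h
  have h0 : squareCoord p * basisVec 0 0
      + ((1 - supNorm (squareCoord p) : ℝ) : ℂ) * basisVec 1 0 = 0 :=
    congrArg (fun y : Hilb => y 0) h
  have h1 : squareCoord p * basisVec 0 1
      + ((1 - supNorm (squareCoord p) : ℝ) : ℂ) * basisVec 1 1 = 0 :=
    congrArg (fun y : Hilb => y 1) h
  have h0' : squareCoord p = 0 := by simpa [basisVec] using h0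
  simp [basisVec, h0', supNorm] at h1

theorem hopfVec_of_mem_boundary {p : Fin 2 → I} (hp : p ∈ Cube.boundary (Fin 2)) :
    hopfVec p = squareCoord p • basisVec 0 := by
  simp [hopfVec, supNorm_squareCoord_eq_one hp]

/-- The base point of the space of lines. -/
def baseLine : Line Hilb := mkLine ⟨basisVec 0, basisVec_ne_zero 0⟩

/-- The Hopf family of lines over the square, constant on the boundary. -/
def hopfMap : C(Fin 2 → I, Line Hilb) :=
  ⟨fun p => mkLine ⟨hopfVec p, hopfVec_ne_zero p⟩,
    continuous_mkLine.comp (continuous_hopfVec.subtype_mk _)⟩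

theorem hopfMap_of_mem_boundary {p : Fin 2 → I} (hp : p ∈ Cube.boundary (Fin 2)) :
    hopfMap p = baseLine := by
  refine Subtype.ext ?_
  change lineProj (hopfVec p) = lineProj (basisVec 0)
  rw [hopfVec_of_mem_boundary hp, lineProj_smul (squareCoord_ne_zero hp)]

/-- The radial retraction of the plane onto the square. -/
def squareRetract (z : ℂ) : Fin 2 → I :=
  ![Set.projIcc 0 1 zero_le_one ((z.re / max 1 (supNorm z) + 1) / 2),
    Set.projIcc 0 1 zero_le_one ((z.im / max 1 (supNorm z) + 1) / 2)]

theorem continuous_squareRetract : Continuous squareRetract := by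
  have h := continuous_supNorm
  have hne : ∀ z, max 1 (supNorm z) ≠ 0 := fun z => by positivity
  refine continuous_pi fun i => ?_
  fin_cases i
  · exact (continuous_projIcc (h := zero_le_one)).comp (by fun_prop (disch := exact hne _))
  · exact (continuous_projIcc (h := zero_le_one)).comp (by fun_prop (disch := exact hne _))

theorem two_mul_projIcc_sub_one {x : ℝ} (hx : |x| ≤ 1) :
    2 * (Set.projIcc (0 : ℝ) 1 zero_le_one ((x + 1) / 2) : ℝ) - 1 = x := by
  rw [abs_le] at hx
  rw [Set.projIcc_of_mem zero_le_one (x := (x + 1) / 2) ⟨by linarith, by linarith⟩]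
  ring

theorem squareCoord_squareRetract (z : ℂ) :
    squareCoord (squareRetract z) = z / (max 1 (supNorm z) : ℝ) := by
  have hpos : 0 < max 1 (supNorm z) := by positivity
  have h : ∀ x : ℝ, |x| ≤ supNorm z → |x / max 1 (supNorm z)| ≤ 1 := fun x hx => by
    rw [abs_div, abs_of_pos hpos, div_le_one hpos]
    exact hx.trans (le_max_right _ _)
  apply Complex.ext
  · rw [Complex.div_ofReal_re]
    exact two_mul_projIcc_sub_one (h _ (le_max_left _ _))
  · rw [Complex.div_ofReal_im]
    exact two_mul_projIcc_sub_one (h _ (le_max_right _ _))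

theorem squareRetract_mem_boundary {z : ℂ} (hz : 1 ≤ supNorm z) :
    squareRetract z ∈ Cube.boundary (Fin 2) := by
  have hpos : 0 < supNorm z := by linarith
  have key : ∀ x : ℝ, |x| = supNorm z →
      Set.projIcc (0 : ℝ) 1 zero_le_one ((x / max 1 (supNorm z) + 1) / 2) = 0 ∨
      Set.projIcc (0 : ℝ) 1 zero_le_one ((x / max 1 (supNorm z) + 1) / 2) = 1 := by
    intro x hx
    rw [max_eq_right hz]
    rcases abs_choice x with h | h
    · right
      rw [← hx, h, div_self (by rw [← h, hx]; exact hpos.ne')]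
      exact Set.projIcc_of_right_le _ (by norm_num)
    · left
      have : x = -supNorm z := by linarith
      rw [this, neg_div, div_self hpos.ne']
      exact Set.projIcc_of_le_left _ (by norm_num)
  rcases max_choice |z.re| |z.im| with h | h
  · exact ⟨0, key z.re h.symm⟩
  · exact ⟨1, key z.im h.symm⟩

/-- The Hopf family admits no homotopy to a constant family through families which are constant
on the boundary of the square. -/
theorem hopfMap_not_null (F : C(I × (Fin 2 → I), Line Hilb)) (h0 : ∀ p, F (0, p) = hopfMap p)
    (hbd : ∀ t, ∀ p ∈ Cube.boundary (Fin 2), ∀ q ∈ Cube.boundary (Fin 2), F (t, p) = F (t, q))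
    (h1 : ∀ p q, F (1, p) = F (1, q)) : False := by
  obtain ⟨v, hv⟩ := exists_section F
  let p₀ : Fin 2 → I := fun _ => 0
  have hp₀ : p₀ ∈ Cube.boundary (Fin 2) := ⟨0, Or.inl rfl⟩
  let T : ℂ → I := fun z => Set.projIcc 0 1 zero_le_one (2 - supNorm z)
  have hT : Continuous T := continuous_projIcc.comp (continuous_const.sub continuous_supNorm)
  have hR := continuous_squareRetract
  let c : ℂ → ℂ := fun z => inner ℂ (v (T z, p₀)) (v (T z, squareRetract z))
  have hc : Continuous c := by fun_prop
  have hc0 : ∀ z, c z ≠ 0 := by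
    intro z
    have hF : F (T z, squareRetract z) = F (T z, p₀) := by
      rcases le_total (supNorm z) 1 with h | h
      · have : T z = 1 := Set.projIcc_of_right_le _ (by linarith)
        rw [this]
        exact h1 _ _
      · exact hbd _ _ (squareRetract_mem_boundary h) _ hp₀
    exact (hv _).2.inner_ne_zero (hv _).1 (hF ▸ (hv (T z, squareRetract z)).2) (hv _).1
  let g : ℂ → ℂ := fun z => inner ℂ (hopfVec (squareRetract z)) (v (0, squareRetract z))
  have hg : Continuous g := (continuous_hopfVec.comp hR).inner (by fun_prop)
  have hon : ∀ p, OnLine (hopfVec p) (F (0, p)) := fun p => by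
    rw [h0]; exact onLine_mkLine _
  have hg0 : ∀ z, g z ≠ 0 := fun z =>
    (hon _).inner_ne_zero (hopfVec_ne_zero _) (hv (0, squareRetract z)).2 (hv _).1
  let K : ℂ := inner ℂ (v (0, p₀)) (basisVec 0)
  have hK : K ≠ 0 := by
    refine (hv (0, p₀)).2.inner_ne_zero (hv _).1 ?_ (basisVec_ne_zero 0)
    rw [h0, hopfMap_of_mem_boundary hp₀]
    exact onLine_mkLine _
  refine false_of_winding ⟨fun z => c z / (g z * K), hc.div (hg.mul continuous_const)
    fun z => mul_ne_zero (hg0 z) hK⟩ (fun z => div_ne_zero (hc0 z) (mul_ne_zero (hg0 z) hK))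
    (R := 4) (by norm_num) fun z hz => ?_
  have hN : 2 ≤ supNorm z := by
    have := Complex.norm_le_abs_re_add_abs_im z
    have h1 : |z.re| ≤ supNorm z := le_max_left _ _
    have h2 : |z.im| ≤ supNorm z := le_max_right _ _
    linarith
  have hTz : T z = 0 := Set.projIcc_of_le_left _ (by linarith)
  have hmem := squareRetract_mem_boundary (z := z) (by linarith)
  obtain ⟨a, ha⟩ := (hon (squareRetract z)).exists_smul (hopfVec_ne_zero _)
    (hv (0, squareRetract z)).2
  have hcoord := squareCoord_squareRetract z
  rw [max_eq_right (by linarith : (1 : ℝ) ≤ supNorm z)] at hcoord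
  have ha0 : a ≠ 0 := by
    rintro rfl
    exact (hv _).1 (ha.trans (zero_smul _ _))
  have hcz : c z = a * squareCoord (squareRetract z) * K := by
    simp only [c, K]
    rw [hTz, ha, hopfVec_of_mem_boundary hmem, inner_smul_right, inner_smul_right, mul_assoc]
  obtain ⟨M, hM, hgz⟩ : ∃ M : ℝ, 0 < M ∧ g z = a * M := by
    refine ⟨‖hopfVec (squareRetract z)‖ ^ 2, pow_pos (norm_pos_iff.2 (hopfVec_ne_zero _)) 2, ?_⟩
    simp only [g]
    rw [ha, inner_smul_right, inner_self_eq_norm_sq_to_K]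
    push_cast
    rfl
  have hNpos : 0 < supNorm z := by linarith
  refine ⟨(supNorm z * M)⁻¹, by positivity, ?_⟩
  have hMne : (M : ℂ) ≠ 0 := by exact_mod_cast hM.ne'
  have hNne : (supNorm z : ℂ) ≠ 0 := by exact_mod_cast hNpos.ne'
  change c z / (g z * K) = _
  rw [hcz, hgz, hcoord, Complex.ofReal_inv, Complex.ofReal_mul]
  field_simp

/-- A countable power of the space of lines. -/
abbrev LinePower : Type := ℕ → Line Hilb

/-- The base point of `LinePower`. -/
def basePower : LinePower := fun _ => baseLine

/-- The Hopf family placed in the `n`-th coordinate. -/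
def hopfLoop (n : ℕ) : GenLoop (Fin 2) LinePower basePower :=
  ⟨⟨fun p => Function.update basePower n (hopfMap p), by fun_prop⟩, fun p hp => by
    change Function.update basePower n (hopfMap p) = basePower
    rw [hopfMap_of_mem_boundary hp]
    exact Function.update_eq_self n basePower⟩

theorem tendsto_hopfLoop :
    Tendsto (fun n => (hopfLoop n).1) atTop (𝓝 (ContinuousMap.const _ basePower)) := by
  rw [ContinuousMap.tendsto_nhds_compactOpen]
  intro K _ U hU hKU
  rcases K.eq_empty_or_nonempty with rfl | ⟨p, hp⟩
  · exact Eventually.of_forall fun n => Set.mapsTo_empty _ _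
  obtain ⟨J, u, hu, hJ⟩ := isOpen_pi_iff.1 hU _ (hKU hp)
  filter_upwards [J.finite_toSet.eventually_cofinite_notMem.filter_mono
    Nat.cofinite_eq_atTop.ge] with n hn q _
  refine hJ fun i hi => ?_
  change Function.update basePower n (hopfMap q) i ∈ u i
  rw [Function.update_of_ne (by rintro rfl; exact hn hi)]
  exact (hu i hi).2

theorem subsingleton_pi_one : Subsingleton (HomotopyGroup (Fin 1) LinePower basePower) := by
  have : Subsingleton (Path.Homotopic.Quotient basePower basePower) := by
    have h : ∀ i, Subsingleton (Path.Homotopic.Quotient (basePower i) (basePower i)) :=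
      fun _ => path_quotient_subsingleton _
    refine ⟨fun p q => ?_⟩
    rw [← Path.Homotopic.pi_proj p, ← Path.Homotopic.pi_proj q]
    exact congrArg _ (funext fun i => Subsingleton.elim _ _)
  have : Subsingleton (FundamentalGroup LinePower basePower) := this
  exact (HomotopyGroup.pi1EquivFundamentalGroup (X := LinePower) (x := basePower)).subsingleton

theorem not_discreteTopology_pi_two {Y : Type*} [TopologicalSpace Y]
    (h : ContinuousMap.HomotopyEquiv LinePower Y) :
    ¬ DiscreteTopology (HomotopyGroup (Fin 2) Y (h.toFun basePower)) := by
  intro hdisc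
  let f : ℕ → GenLoop (Fin 2) Y (h.toFun basePower) := fun n =>
    ⟨h.toFun.comp (hopfLoop n).1, fun p hp => congrArg h.toFun ((hopfLoop n).2 p hp)⟩
  have hf : Tendsto f atTop (𝓝 GenLoop.const) := by
    rw [tendsto_subtype_rng]
    exact ((ContinuousMap.continuous_postcomp h.toFun).tendsto _).comp tendsto_hopfLoop
  have hopen : IsOpen {l : GenLoop (Fin 2) Y (h.toFun basePower) |
      (Quotient.mk _ l : HomotopyGroup (Fin 2) Y _) = Quotient.mk _ GenLoop.const} :=
    (@isOpen_discrete _ _ hdisc {Quotient.mk _ GenLoop.const}).preimage continuous_quotient_mk'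
  obtain ⟨n, hn⟩ := (hf.eventually (hopen.mem_nhds rfl)).exists
  obtain ⟨G⟩ : GenLoop.Homotopic (f n) GenLoop.const := Quotient.exact hn
  obtain ⟨L⟩ := h.left_inv
  let P : C(Fin 2 → I, LinePower) → Prop := fun k =>
    ∀ p ∈ Cube.boundary (Fin 2), ∀ q ∈ Cube.boundary (Fin 2), k p = k q
  have hbd : ∀ p ∈ Cube.boundary (Fin 2), (hopfLoop n).1 p = basePower := (hopfLoop n).2
  let A : ContinuousMap.HomotopyWith (hopfLoop n).1
      ((h.invFun.comp h.toFun).comp (hopfLoop n).1) P :=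
    { toFun := fun q => L.symm (q.1, (hopfLoop n).1 q.2)
      continuous_toFun := by fun_prop
      map_zero_left := fun p => by simp
      map_one_left := fun p => by simp
      prop' := fun t p hp q hq => by
        change L.symm (t, (hopfLoop n).1 p) = L.symm (t, (hopfLoop n).1 q)
        rw [hbd p hp, hbd q hq] }
  let B : ContinuousMap.HomotopyWith ((h.invFun.comp h.toFun).comp (hopfLoop n).1)
      (ContinuousMap.const _ (h.invFun (h.toFun basePower))) P :=
    { toFun := fun q => h.invFun (G q)
      continuous_toFun := by fun_prop
      map_zero_left := fun p => by simp [f]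
      map_one_left := fun p => by simp
      prop' := fun t p hp q hq => by
        change h.invFun (G (t, p)) = h.invFun (G (t, q))
        rw [G.eq_fst t hp, G.eq_fst t hq, (f n).2 p hp, (f n).2 q hq] }
  let C := A.trans B
  refine hopfMap_not_null ⟨fun q => C q n, (continuous_apply n).comp C.continuous⟩ (fun p => ?_)
    (fun t p hp q hq => congrFun (C.prop t p hp q hq) n) fun p q => ?_
  · change C (0, p) n = _
    rw [C.apply_zero]
    exact Function.update_self _ _ _
  · change C (1, p) n = C (1, q) n
    rw [C.apply_one, C.apply_one]
    rfl

theorem hasTrivialPi1ButNonDiscretePi2 :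
    @HasTrivialPi1ButNonDiscretePi2 LinePower
      (TopologicalSpace.metrizableSpaceMetric LinePower) basePower := by
  have := subsingleton_pi_one
  exact ⟨this, inferInstance,
    not_discreteTopology_pi_two (ContinuousMap.HomotopyEquiv.refl LinePower),
    fun Y _ h => not_discreteTopology_pi_two h⟩

end LineSpace

end

/-- There exists a metric space (the 2-dimensional Hawaiian earring) with trivial
π₁^top but non-discrete π₂^top; hence it is not homotopy equivalent to any space
whose π₂^top is discrete. -/
theorem exists_trivial_pi1_nonDiscrete_pi2 :
    ∃ (X : Type) (m : MetricSpace X) (x : X), @HasTrivialPi1ButNonDiscretePi2 X m x := by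
  exact ⟨_, _, _, LineSpace.hasTrivialPi1ButNonDiscretePi2⟩
end
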